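/- arXiv:2204.07706 — 3 statements merged into one kernel-verified Lean document; each statement's English description precedes it below -/
import Mathlib

section
/- Let F be a connected GSC. For any x ∈ F, the complement F \ {x} has at most eight connected components. -/
/-- The map φ_d(x) = (x + d)/N on ℝ². -/
noncomputable def phi (N : ℕ) (d : ℕ × ℕ) (x : ℝ × ℝ) : ℝ × ℝ :=
  ((x.1 + d.1) / N, (x.2 + d.2) / N)

/-- The set `X` is covered by the connected components of at most `K` of its points. -/
def ComponentsLE (X : Set (ℝ × ℝ)) (K : ℕ) : Prop :=
  ∃ t : Finset (ℝ × ℝ), t.card ≤ K ∧ ∀ y ∈ X, ∃ p ∈ t, y ∈ connectedComponentIn X p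

/-- The integer vector `v` is a difference of two points of `F`. -/
def Touches (F : Set (ℝ × ℝ)) (v : ℤ × ℤ) : Prop :=
  ∃ p ∈ F, ∃ q ∈ F, q.1 - p.1 = v.1 ∧ q.2 - p.2 = v.2

/-- The difference of two digits as an integer vector. -/
def offset (e d : ℕ × ℕ) : ℤ × ℤ := ((e.1 : ℤ) - d.1, (e.2 : ℤ) - d.2)

/-- `F` is the union of its copies under the maps `phi N d`, `d ∈ D`, with digits `D` below `N`. -/
structure SelfSimilar (N : ℕ) (D : Finset (ℕ × ℕ)) (F : Set (ℝ × ℝ)) : Prop where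
  lt : ∀ d ∈ D, d.1 < N ∧ d.2 < N
  eq : F = ⋃ d ∈ D, phi N d '' F

lemma componentsLE_of_separated {X : Set (ℝ × ℝ)} {K : ℕ}
    (h : ∀ P : Finset (ℝ × ℝ), (∀ y ∈ P, y ∈ X) →
      (∀ y ∈ P, ∀ z ∈ P, z ∈ connectedComponentIn X y → y = z) → P.card ≤ K) :
    ComponentsLE X K := by
  classical
  let Q : ℕ → Prop := fun m => ∃ P : Finset (ℝ × ℝ), P.card = m ∧ (∀ y ∈ P, y ∈ X) ∧
    (∀ y ∈ P, ∀ z ∈ P, z ∈ connectedComponentIn X y → y = z)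
  have hQ0 : Q 0 := ⟨∅, by simp, by simp, by simp⟩
  obtain ⟨P, hPc, hPX, hPs⟩ : Q (Nat.findGreatest Q K) :=
    Nat.findGreatest_spec (Nat.zero_le K) hQ0
  refine ⟨P, h P hPX hPs, fun y hy => ?_⟩
  by_contra! hcon
  have hyP : y ∉ P := fun hyP => hcon y hyP (mem_connectedComponentIn hy)
  have hins : Q (P.card + 1) := by
    refine ⟨insert y P, Finset.card_insert_of_notMem hyP, ?_, ?_⟩
    · intro z hz
      rcases Finset.mem_insert.1 hz with rfl | hz
      exacts [hy, hPX z hz]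
    · intro a ha b hb hab
      rcases Finset.mem_insert.1 ha with rfl | ha' <;>
        rcases Finset.mem_insert.1 hb with rfl | hb'
      · rfl
      · exact absurd (connectedComponentIn_eq hab ▸ mem_connectedComponentIn hy) (hcon b hb')
      · exact absurd hab (hcon a ha')
      · exact hPs a ha' b hb' hab
  have hle : P.card + 1 ≤ K := by
    obtain ⟨P', hc, h1, h2⟩ := hins
    exact hc ▸ h P' h1 h2
  have := Nat.le_findGreatest hle hins
  omega

lemma continuous_phi (N : ℕ) (d : ℕ × ℕ) : Continuous (phi N d) := by
  unfold phi
  fun_prop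

lemma phi_injective {N : ℕ} (hN : 0 < N) (d : ℕ × ℕ) : Function.Injective (phi N d) := by
  have hN' : (N : ℝ) ≠ 0 := by positivity
  intro p q h
  simp only [phi, Prod.mk.injEq, div_left_inj' hN', add_left_inj] at h
  exact Prod.ext h.1 h.2

lemma image_inter_nonempty_iff {N : ℕ} (hN : 0 < N) {F : Set (ℝ × ℝ)} {e d : ℕ × ℕ} :
    (phi N e '' F ∩ phi N d '' F).Nonempty ↔ Touches F (offset e d) := by
  have hN' : (N : ℝ) ≠ 0 := by positivity
  constructor
  · rintro ⟨_, ⟨p, hp, rfl⟩, ⟨q, hq, h⟩⟩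
    simp only [phi, Prod.mk.injEq, div_left_inj' hN'] at h
    refine ⟨p, hp, q, hq, ?_, ?_⟩ <;> simp only [offset] <;> push_cast <;> linarith [h.1, h.2]
  · rintro ⟨p, hp, q, hq, h1, h2⟩
    simp only [offset] at h1 h2
    push_cast at h1 h2
    refine ⟨phi N e p, ⟨p, hp, rfl⟩, ⟨q, hq, ?_⟩⟩
    simp only [phi, Prod.mk.injEq, div_left_inj' hN']
    exact ⟨by linarith, by linarith⟩

namespace SelfSimilar

variable {N M : ℕ} {D E : Finset (ℕ × ℕ)} {F : Set (ℝ × ℝ)}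

lemma exists_mem (h : SelfSimilar N D F) {x : ℝ × ℝ} (hx : x ∈ F) :
    ∃ d ∈ D, x ∈ phi N d '' F := by
  rw [h.eq] at hx
  simpa using hx

lemma image_subset (h : SelfSimilar N D F) {d : ℕ × ℕ} (hd : d ∈ D) : phi N d '' F ⊆ F := by
  conv_rhs => rw [h.eq]
  exact Set.subset_biUnion_of_mem (u := fun d => phi N d '' F) hd

lemma mul (hM : SelfSimilar M E F) (hN : SelfSimilar N D F) (hM0 : 0 < M) (hN0 : 0 < N) :
    ∃ G, SelfSimilar (M * N) G F := by
  classical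
  have hN' : (N : ℝ) ≠ 0 := by positivity
  have hM' : (M : ℝ) ≠ 0 := by positivity
  have key : ∀ (e d : ℕ × ℕ) (p : ℝ × ℝ),
      phi (M * N) (N * e.1 + d.1, N * e.2 + d.2) p = phi M e (phi N d p) := by
    intro e d p
    simp only [phi, Prod.mk.injEq]
    push_cast
    constructor <;> field_simp <;> ring
  refine ⟨(E ×ˢ D).image fun q => (N * q.1.1 + q.2.1, N * q.1.2 + q.2.2), ?_, ?_⟩
  · intro g hg
    simp only [Finset.mem_image, Finset.mem_product] at hg
    obtain ⟨⟨e, d⟩, ⟨he, hd⟩, rfl⟩ := hg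
    have := hM.lt e he
    have := hN.lt d hd
    constructor <;> simp only <;> nlinarith
  · ext x
    simp only [Set.mem_iUnion, Finset.mem_image, Finset.mem_product]
    constructor
    · intro hx
      obtain ⟨e, he, p, hp, rfl⟩ := hM.exists_mem hx
      obtain ⟨d, hd, q, hq, rfl⟩ := hN.exists_mem hp
      exact ⟨_, ⟨(e, d), ⟨he, hd⟩, rfl⟩, q, hq, key e d q⟩
    · rintro ⟨_, ⟨⟨e, d⟩, ⟨he, hd⟩, rfl⟩, q, hq, rfl⟩
      rw [key]
      exact hM.image_subset he ⟨_, hN.image_subset hd ⟨q, hq, rfl⟩, rfl⟩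

lemma pow (h : SelfSimilar N D F) (hN : 0 < N) (n : ℕ) : ∃ G, SelfSimilar (N ^ n) G F := by
  induction n with
  | zero =>
    refine ⟨{(0, 0)}, by simp, ?_⟩
    have : phi (N ^ 0) (0, 0) = id := by
      funext p
      simp [phi]
    rw [Finset.set_biUnion_singleton, this, Set.image_id]
  | succ n ih =>
    obtain ⟨G, hG⟩ := ih
    exact hG.mul h (by positivity) hN

lemma mem_unit (h : SelfSimilar N D F) (hN : 2 ≤ N) (hF : IsCompact F) {p : ℝ × ℝ} (hp : p ∈ F) :
    (0 ≤ p.1 ∧ p.1 ≤ 1) ∧ (0 ≤ p.2 ∧ p.2 ≤ 1) := by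
  have hN' : (2 : ℝ) ≤ N := by exact_mod_cast hN
  have coord : ∀ f : ℝ × ℝ → ℝ, Continuous f →
      (∀ d ∈ D, ∃ a : ℝ, 0 ≤ a ∧ a ≤ N - 1 ∧ ∀ q, f (phi N d q) = (f q + a) / N) →
      0 ≤ f p ∧ f p ≤ 1 := by
    intro f hf hfd
    constructor
    · obtain ⟨m, hm, hmin⟩ := hF.exists_isMinOn ⟨p, hp⟩ hf.continuousOn
      obtain ⟨d, hd, q, hq, rfl⟩ := h.exists_mem hm
      obtain ⟨a, ha0, -, ha⟩ := hfd d hd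
      have h1 := hmin hq
      have h2 := hmin hp
      simp only [Set.mem_ofPred_eq] at h1 h2
      have h3 : f (phi N d q) * N = f q + a := by rw [ha]; field_simp
      nlinarith
    · obtain ⟨m, hm, hmax⟩ := hF.exists_isMaxOn ⟨p, hp⟩ hf.continuousOn
      obtain ⟨d, hd, q, hq, rfl⟩ := h.exists_mem hm
      obtain ⟨a, -, ha1, ha⟩ := hfd d hd
      have h1 := hmax hq
      have h2 := hmax hp
      simp only [Set.mem_ofPred_eq] at h1 h2
      have h3 : f (phi N d q) * N = f q + a := by rw [ha]; field_simp
      nlinarith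
  have digit : ∀ a : ℕ, a < N → (a : ℝ) ≤ N - 1 := by
    intro a ha
    have : ((a + 1 : ℕ) : ℝ) ≤ N := by exact_mod_cast ha
    push_cast at this
    linarith
  exact ⟨coord Prod.fst continuous_fst fun d hd =>
      ⟨d.1, by positivity, digit _ (h.lt d hd).1, fun q => rfl⟩,
    coord Prod.snd continuous_snd fun d hd =>
      ⟨d.2, by positivity, digit _ (h.lt d hd).2, fun q => rfl⟩⟩

/-- The component of `F \ {x}` of a point lying in a cell that misses `x` contains a cell that
touches a cell containing `x`. -/
lemma exists_cell_touching (h : SelfSimilar N D F) (hF : IsCompact F)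
    (hconn : IsConnected F) {x y : ℝ × ℝ} (hx : x ∈ F) {c : ℕ × ℕ} (hc : c ∈ D)
    (hyc : y ∈ phi N c '' F) (hxc : x ∉ phi N c '' F) :
    ∃ e ∈ D, x ∉ phi N e '' F ∧ phi N e '' F ⊆ connectedComponentIn (F \ {x}) y ∧
      ∃ d ∈ D, x ∈ phi N d '' F ∧ (phi N e '' F ∩ phi N d '' F).Nonempty := by
  classical
  have hcell : ∀ e, IsConnected (phi N e '' F) := fun e =>
    hconn.image _ (continuous_phi N e).continuousOn
  have hclosed : ∀ e, IsClosed (phi N e '' F) := fun e =>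
    (hF.image (continuous_phi N e)).isClosed
  have hsub : ∀ e ∈ D, x ∉ phi N e '' F → phi N e '' F ⊆ F \ {x} := fun e he hxe z hz =>
    ⟨h.image_subset he hz, fun hzx => hxe (by rwa [← Set.mem_singleton_iff.1 hzx])⟩
  let S := D.filter fun e =>
    x ∉ phi N e '' F ∧ phi N e '' F ⊆ connectedComponentIn (F \ {x}) y
  let R := D.filter fun e =>
    ¬ (x ∉ phi N e '' F ∧ phi N e '' F ⊆ connectedComponentIn (F \ {x}) y)
  have hcS : c ∈ S := Finset.mem_filter.2 ⟨hc, hxc,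
    (hcell c).isPreconnected.subset_connectedComponentIn hyc (hsub c hc hxc)⟩
  obtain ⟨d₀, hd₀, hxd₀⟩ := h.exists_mem hx
  have hd₀R : d₀ ∈ R := Finset.mem_filter.2 ⟨hd₀, fun hh => hh.1 hxd₀⟩
  have hclU : ∀ A : Finset (ℕ × ℕ), IsClosed (⋃ e ∈ A, phi N e '' F) := fun A =>
    A.finite_toSet.isClosed_biUnion fun e _ => hclosed e
  have hcover : F ⊆ (⋃ e ∈ S, phi N e '' F) ∪ ⋃ e ∈ R, phi N e '' F := by
    intro z hz
    obtain ⟨e, he, hze⟩ := h.exists_mem hz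
    by_cases hP : x ∉ phi N e '' F ∧ phi N e '' F ⊆ connectedComponentIn (F \ {x}) y
    · exact Or.inl (Set.mem_biUnion (Finset.mem_filter.2 ⟨he, hP⟩) hze)
    · exact Or.inr (Set.mem_biUnion (Finset.mem_filter.2 ⟨he, hP⟩) hze)
  obtain ⟨z, -, hzS, hzR⟩ := isPreconnected_closed_iff.1 hconn.isPreconnected _ _
    (hclU S) (hclU R) hcover
    ⟨y, h.image_subset hc hyc, Set.mem_biUnion hcS hyc⟩
    ⟨x, hx, Set.mem_biUnion hd₀R hxd₀⟩
  simp only [Set.mem_iUnion] at hzS hzR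
  obtain ⟨e, heS, hze⟩ := hzS
  obtain ⟨d, hdR, hzd⟩ := hzR
  obtain ⟨he, hxe, hecomp⟩ := Finset.mem_filter.1 heS
  obtain ⟨hd, hdcomp⟩ := Finset.mem_filter.1 hdR
  refine ⟨e, he, hxe, hecomp, d, hd, ?_, z, hze, hzd⟩
  by_contra hxd
  refine hdcomp ⟨hxd, ?_⟩
  rw [connectedComponentIn_eq (hecomp hze)]
  exact (hcell d).isPreconnected.subset_connectedComponentIn hzd (hsub d hd hxd)

lemma componentsLE_of_cells (h : SelfSimilar N D F) (hN : 0 < N) (hF : IsCompact F)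
    (hconn : IsConnected F) {x : ℝ × ℝ} (hx : x ∈ F) {A : Finset (ℕ × ℕ)}
    (hA : ∀ d ∈ D, x ∈ phi N d '' F → d ∈ A) {k K : ℕ} (hk : A.card ≤ k)
    (hK : ∀ d ∈ D, ∀ z ∈ F, phi N d z = x → ComponentsLE (F \ {z}) K) :
    ComponentsLE (F \ {x}) (k * K) := by
  classical
  have hcells : ∀ d : ℕ × ℕ, ∃ t : Finset (ℝ × ℝ), t.card ≤ K ∧
      (d ∈ D → x ∈ phi N d '' F → ∀ y ∈ phi N d '' F, y ≠ x →
        ∃ p ∈ t, y ∈ connectedComponentIn (F \ {x}) p) := by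
    intro d
    by_cases hd : d ∈ D ∧ x ∈ phi N d '' F
    · obtain ⟨hd, z, hz, hzx⟩ := hd
      obtain ⟨t, ht, htc⟩ := hK d hd z hz hzx
      refine ⟨t.image (phi N d), Finset.card_image_le.trans ht, ?_⟩
      rintro - - _ ⟨w, hw, rfl⟩ hwx
      obtain ⟨p, hp, hpw⟩ := htc w ⟨hw, fun hwz => hwx (by rw [Set.mem_singleton_iff.1 hwz, hzx])⟩
      refine ⟨_, Finset.mem_image_of_mem _ hp, ?_⟩
      have hpF : p ∈ F \ {z} := connectedComponentIn_nonempty_iff.1 ⟨w, hpw⟩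
      have hsub : phi N d '' connectedComponentIn (F \ {z}) p ⊆ F \ {x} := by
        rintro _ ⟨q, hq, rfl⟩
        have hq' := connectedComponentIn_subset _ _ hq
        exact ⟨h.image_subset hd ⟨q, hq'.1, rfl⟩, fun hqx =>
          hq'.2 (phi_injective hN d ((Set.mem_singleton_iff.1 hqx).trans hzx.symm))⟩
      exact (isPreconnected_connectedComponentIn.image _
        (continuous_phi N d).continuousOn).subset_connectedComponentIn
        ⟨p, mem_connectedComponentIn hpF, rfl⟩ hsub ⟨w, hpw, rfl⟩
    · exact ⟨∅, by simp, fun h1 h2 => absurd ⟨h1, h2⟩ hd⟩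
  choose t ht htc using hcells
  refine ⟨A.biUnion t, (Finset.card_biUnion_le_card_mul A t K fun d _ => ht d).trans
    (Nat.mul_le_mul_right K hk), fun y hy => ?_⟩
  obtain ⟨c, hc, hyc⟩ := h.exists_mem hy.1
  by_cases hxc : x ∈ phi N c '' F
  · obtain ⟨p, hp, hyp⟩ := htc c hc hxc y hyc hy.2
    exact ⟨p, Finset.mem_biUnion.2 ⟨c, hA c hc hxc, hp⟩, hyp⟩
  · obtain ⟨e, he, hxe, hecomp, d, hd, hxd, w, hwe, hwd⟩ :=
      h.exists_cell_touching hF hconn hx hc hyc hxc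
    obtain ⟨p, hp, hwp⟩ := htc d hd hxd w hwd fun hwx => hxe (hwx ▸ hwe)
    refine ⟨p, Finset.mem_biUnion.2 ⟨d, hA d hd hxd, hp⟩, ?_⟩
    rw [connectedComponentIn_eq hwp, ← connectedComponentIn_eq (hecomp hwe)]
    exact mem_connectedComponentIn hy

/-- Points of `P` in distinct components of `F \ {x}`, outside the only cell `d` containing `x`,
are injectively assigned pairwise disjoint cells that touch `d`. -/
lemma exists_offsets (h : SelfSimilar N D F) (hN : 0 < N) (hF : IsCompact F)
    (hconn : IsConnected F) {x : ℝ × ℝ} (hx : x ∈ F) {d : ℕ × ℕ}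
    (huniq : ∀ e ∈ D, x ∈ phi N e '' F → e = d) {P : Finset (ℝ × ℝ)}
    (hP : ∀ y ∈ P, y ∈ F ∧ y ∉ phi N d '' F)
    (hsep : ∀ y ∈ P, ∀ z ∈ P, z ∈ connectedComponentIn (F \ {x}) y → y = z) :
    ∃ S : Finset (ℤ × ℤ), S.card = P.card ∧
      (∀ v ∈ S, ∃ e ∈ D, v = offset e d ∧ e ≠ d ∧ Touches F v) ∧
      ∀ v ∈ S, ∀ w ∈ S, Touches F (v - w) → v = w := by
  classical
  obtain ⟨d', hd', hxd'⟩ := h.exists_mem hx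
  obtain rfl := huniq d' hd' hxd'
  have hyF : ∀ y ∈ P, y ∈ F \ {x} := fun y hy =>
    ⟨(hP y hy).1, fun hyx => (hP y hy).2 (by rwa [Set.mem_singleton_iff.1 hyx])⟩
  have hex : ∀ y, ∃ e : ℕ × ℕ, y ∈ P → e ∈ D ∧ e ≠ d' ∧
      phi N e '' F ⊆ connectedComponentIn (F \ {x}) y ∧ Touches F (offset e d') := by
    intro y
    by_cases hy : y ∈ P
    · obtain ⟨c, hc, hyc⟩ := h.exists_mem (hP y hy).1
      have hxc : x ∉ phi N c '' F := fun hxc => (hP y hy).2 (huniq c hc hxc ▸ hyc)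
      obtain ⟨e, he, hxe, hecomp, d, hd, hxd, hne⟩ :=
        h.exists_cell_touching hF hconn hx hc hyc hxc
      obtain rfl := huniq d hd hxd
      exact ⟨e, fun _ => ⟨he, fun hed => hxe (hed ▸ hxd), hecomp,
        (image_inter_nonempty_iff hN).1 hne⟩⟩
    · exact ⟨0, fun h => absurd h hy⟩
  choose e he using hex
  have hdisj : ∀ y ∈ P, ∀ z ∈ P, Touches F (offset (e y) d' - offset (e z) d') → y = z := by
    intro y hy z hz hT
    have hoff : offset (e y) d' - offset (e z) d' = offset (e y) (e z) := by
      simp [offset]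
    rw [hoff, ← image_inter_nonempty_iff hN] at hT
    obtain ⟨w, hwy, hwz⟩ := hT
    apply hsep y hy z hz
    rw [connectedComponentIn_eq ((he y hy).2.2.1 hwy),
      ← connectedComponentIn_eq ((he z hz).2.2.1 hwz)]
    exact mem_connectedComponentIn (hyF z hz)
  refine ⟨P.image fun y => offset (e y) d', Finset.card_image_of_injOn ?_, ?_, ?_⟩
  · intro y hy z hz hyz
    refine hdisj y hy z hz ⟨x, hx, x, hx, ?_⟩
    simp only at hyz
    simp [hyz]
  · intro v hv
    obtain ⟨y, hy, rfl⟩ := Finset.mem_image.1 hv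
    exact ⟨e y, (he y hy).1, rfl, (he y hy).2.1, (he y hy).2.2.2⟩
  · intro v hv w hw hT
    obtain ⟨y, hy, rfl⟩ := Finset.mem_image.1 hv
    obtain ⟨z, hz, rfl⟩ := Finset.mem_image.1 hw
    rw [hdisj y hy z hz hT]

end SelfSimilar

lemma floor_eq_of_sub_mem {t : ℝ} (ht : ∀ k : ℤ, t ≠ k) {a : ℕ}
    (hta : 0 ≤ t - a ∧ t - a ≤ 1) : ⌊t⌋ = a := by
  refine Int.floor_eq_iff.2 ⟨by push_cast; linarith [hta.1], ?_⟩
  refine lt_of_le_of_ne (by push_cast; linarith [hta.2]) fun hh => ht (a + 1) ?_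
  push_cast at hh ⊢
  exact hh

lemma digit_unique {t : ℝ} {M a b : ℕ} (ha : a < M) (hb : b < M)
    (hta : 0 ≤ M * t - a ∧ M * t - a ≤ 1) (htb : 0 ≤ M * t - b ∧ M * t - b ≤ 1)
    (ht : t = 0 ∨ t = 1 ∨ ∀ k : ℤ, (M : ℝ) * t ≠ k) : a = b := by
  rcases ht with rfl | rfl | ht
  · have h1 : (a : ℝ) ≤ 0 := by linarith [hta.1]
    have h2 : (b : ℝ) ≤ 0 := by linarith [htb.1]
    norm_cast at h1 h2
    omega
  · have h1 : (M : ℝ) ≤ a + 1 := by linarith [hta.2]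
    have h2 : (M : ℝ) ≤ b + 1 := by linarith [htb.2]
    norm_cast at h1 h2
    omega
  · exact_mod_cast (floor_eq_of_sub_mem ht hta).symm.trans (floor_eq_of_sub_mem ht htb)

lemma card_le_of_touches {F : Set (ℝ × ℝ)} {S W : Finset (ℤ × ℤ)} {K : ℕ} (hSW : S ⊆ W)
    (hS : ∀ v ∈ S, Touches F v) (hS' : ∀ v ∈ S, ∀ w ∈ S, Touches F (v - w) → v = w)
    (hW : W.card ≤ K ∨ W.card = K + 1 ∧ ∃ a ∈ W, ∃ b ∈ W, a ≠ b ∧ a - b ∈ W) : S.card ≤ K := by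
  rcases hW with hW | ⟨hW, a, ha, b, hb, hab, hc⟩
  · exact (Finset.card_le_card hSW).trans hW
  · by_contra! hcard
    obtain rfl := Finset.eq_of_subset_of_card_le hSW (by omega)
    exact hab (hS' a ha b hb (hS _ hc))

/-- The nonzero offsets to adjacent squares available to a cell containing `z`. -/
def AllowedOffset (z : ℝ × ℝ) (v : ℤ × ℤ) : Prop :=
  v ≠ 0 ∧ (-1 ≤ v.1 ∧ v.1 ≤ 1) ∧ (-1 ≤ v.2 ∧ v.2 ≤ 1) ∧ (z.1 = 0 → 0 ≤ v.1) ∧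
    (z.1 = 1 → v.1 ≤ 0) ∧ (z.2 = 0 → 0 ≤ v.2) ∧ (z.2 = 1 → v.2 ≤ 0)

/-- `t` is an endpoint of the unit interval or no endpoint of an `N`-adic interval of any level;
a point of the unit interval with this property lies in only one `N`-adic interval per level. -/
def UniqueDigits (N : ℕ) (t : ℝ) : Prop :=
  t = 0 ∨ t = 1 ∨ ∀ (n : ℕ) (k : ℤ), (N : ℝ) ^ n * t ≠ k

lemma mul_sub_mem_unit {M : ℕ} {F : Set (ℝ × ℝ)} (hM : 0 < M)
    (hunit : ∀ p ∈ F, (0 ≤ p.1 ∧ p.1 ≤ 1) ∧ (0 ≤ p.2 ∧ p.2 ≤ 1)) {d : ℕ × ℕ} {z : ℝ × ℝ}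
    (hz : z ∈ phi M d '' F) :
    (0 ≤ M * z.1 - d.1 ∧ M * z.1 - d.1 ≤ 1) ∧ (0 ≤ M * z.2 - d.2 ∧ M * z.2 - d.2 ≤ 1) := by
  have hM' : (M : ℝ) ≠ 0 := by positivity
  obtain ⟨p, hp, rfl⟩ := hz
  have := hunit p hp
  simpa only [phi, mul_div_cancel₀ _ hM', add_sub_cancel_right] using this

namespace SelfSimilar

variable {N : ℕ} {D : Finset (ℕ × ℕ)} {F : Set (ℝ × ℝ)} {z : ℝ × ℝ}

lemma componentsLE_of_allowedOffset (h : SelfSimilar N D F) (hN : 2 ≤ N) (hF : IsCompact F)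
    (hconn : IsConnected F) (hz : z ∈ F) (hz1 : UniqueDigits N z.1) (hz2 : UniqueDigits N z.2)
    {W : Finset (ℤ × ℤ)} (hW : ∀ v, AllowedOffset z v → v ∈ W) {K : ℕ}
    (hK : W.card ≤ K ∨ W.card = K + 1 ∧ ∃ a ∈ W, ∃ b ∈ W, a ≠ b ∧ a - b ∈ W) :
    ComponentsLE (F \ {z}) K := by
  have hunit := fun p (hp : p ∈ F) => h.mem_unit hN hF hp
  have hN1 : (1 : ℝ) < N := by exact_mod_cast hN
  refine componentsLE_of_separated fun P hP hsep => ?_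
  obtain ⟨n, hn⟩ : ∃ n : ℕ, ∀ y ∈ P, ((N : ℝ)⁻¹) ^ n < dist y z := by
    have hlim := tendsto_pow_atTop_nhds_zero_of_lt_one (r := (N : ℝ)⁻¹) (by positivity)
      (inv_lt_one_of_one_lt₀ hN1)
    have := (Filter.eventually_all_finset P).2 fun y hy =>
      hlim.eventually_lt_const (dist_pos.2 (hP y hy).2 : (0 : ℝ) < dist y z)
    exact this.exists
  obtain ⟨E, hE⟩ := h.pow (by omega) n
  have hM : 0 < N ^ n := by positivity
  obtain ⟨d, hd, hzd⟩ := hE.exists_mem hz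
  have hzd' := mul_sub_mem_unit hM hunit hzd
  have huniq : ∀ e ∈ E, z ∈ phi (N ^ n) e '' F → e = d := by
    intro e he hze
    have hze' := mul_sub_mem_unit hM hunit hze
    have coord : ∀ t : ℝ, UniqueDigits N t →
        t = 0 ∨ t = 1 ∨ ∀ k : ℤ, ((N ^ n : ℕ) : ℝ) * t ≠ k := by
      intro t ht
      push_cast
      exact ht.imp_right (Or.imp_right fun ht k => ht n k)
    exact Prod.ext
      (digit_unique (hE.lt e he).1 (hE.lt d hd).1 hze'.1 hzd'.1 (coord _ hz1))
      (digit_unique (hE.lt e he).2 (hE.lt d hd).2 hze'.2 hzd'.2 (coord _ hz2))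
  have hfar : ∀ y ∈ P, y ∈ F ∧ y ∉ phi (N ^ n) d '' F := by
    intro y hy
    refine ⟨(hP y hy).1, fun hyd => (hn y hy).not_ge ?_⟩
    have hyd' := mul_sub_mem_unit hM hunit hyd
    have hM' : (0 : ℝ) < ((N ^ n : ℕ) : ℝ) := by exact_mod_cast hM
    have coord : ∀ s t a : ℝ, (0 ≤ ((N ^ n : ℕ) : ℝ) * s - a ∧ ((N ^ n : ℕ) : ℝ) * s - a ≤ 1) →
        (0 ≤ ((N ^ n : ℕ) : ℝ) * t - a ∧ ((N ^ n : ℕ) : ℝ) * t - a ≤ 1) →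
        dist s t ≤ ((N : ℝ)⁻¹) ^ n := by
      intro s t a hs ht
      have hpow : ((N : ℝ)⁻¹) ^ n = 1 / ((N ^ n : ℕ) : ℝ) := by
        push_cast
        rw [inv_pow, one_div]
      rw [hpow, Real.dist_eq, le_div_iff₀ hM', ← abs_of_pos hM', ← abs_mul, abs_le]
      constructor <;> nlinarith [hs.1, hs.2, ht.1, ht.2]
    rw [Prod.dist_eq]
    exact max_le (coord _ _ _ hyd'.1 hzd'.1) (coord _ _ _ hyd'.2 hzd'.2)
  obtain ⟨S, hSc, hSe, hS⟩ := hE.exists_offsets hM hF hconn hz huniq hfar hsep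
  rw [← hSc]
  refine card_le_of_touches (fun v hv => hW v ?_) (fun v hv => ?_) hS hK
  · obtain ⟨e, he, rfl, hed, p, hp, q, hq, hv1, hv2⟩ := hSe v hv
    obtain ⟨⟨hp1, hp2⟩, hp3, hp4⟩ := hunit p hp
    obtain ⟨⟨hq1, hq2⟩, hq3, hq4⟩ := hunit q hq
    have hlt := hE.lt e he
    refine ⟨fun h0 => hed ?_, ⟨?_, ?_⟩, ⟨?_, ?_⟩, fun h0 => ?_, fun h0 => ?_, fun h0 => ?_,
      fun h0 => ?_⟩
    · simp only [offset, Prod.mk_eq_zero] at h0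
      exact Prod.ext (by omega) (by omega)
    · have : (-1 : ℝ) ≤ (offset e d).1 := by linarith
      exact_mod_cast this
    · have : ((offset e d).1 : ℝ) ≤ 1 := by linarith
      exact_mod_cast this
    · have : (-1 : ℝ) ≤ (offset e d).2 := by linarith
      exact_mod_cast this
    · have : ((offset e d).2 : ℝ) ≤ 1 := by linarith
      exact_mod_cast this
    · have : (d.1 : ℝ) ≤ 0 := by simpa [h0] using hzd'.1.1
      norm_cast at this
      simp only [offset]
      omega
    · have : ((N ^ n : ℕ) : ℝ) ≤ d.1 + 1 := by
        have := hzd'.1.2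
        rw [h0] at this
        linarith
      norm_cast at this
      simp only [offset]
      omega
    · have : (d.2 : ℝ) ≤ 0 := by simpa [h0] using hzd'.2.1
      norm_cast at this
      simp only [offset]
      omega
    · have : ((N ^ n : ℕ) : ℝ) ≤ d.2 + 1 := by
        have := hzd'.2.2
        rw [h0] at this
        linarith
      norm_cast at this
      simp only [offset]
      omega
  · obtain ⟨e, -, -, -, hT⟩ := hSe v hv
    exact hT

end SelfSimilar

/-- The offsets to the eight squares surrounding a given one. -/
noncomputable def adjacentOffsets : Finset (ℤ × ℤ) :=
  (Finset.Icc (-1) 1 ×ˢ Finset.Icc (-1) 1).filter (· ≠ 0)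

namespace AllowedOffset

variable {z : ℝ × ℝ}

lemma mem_adjacentOffsets {v : ℤ × ℤ} (hv : AllowedOffset z v) : v ∈ adjacentOffsets := by
  simp only [adjacentOffsets, Finset.mem_filter, Finset.mem_product, Finset.mem_Icc]
  exact ⟨⟨hv.2.1, hv.2.2.1⟩, hv.1⟩

lemma exists_sign_fst (hz : z.1 = 0 ∨ z.1 = 1) :
    ∃ s : ℤ, (s = 1 ∨ s = -1) ∧ ∀ v, AllowedOffset z v → 0 ≤ s * v.1 := by
  rcases hz with hz | hz
  · exact ⟨1, Or.inl rfl, fun v hv => by simpa using hv.2.2.2.1 hz⟩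
  · exact ⟨-1, Or.inr rfl, fun v hv => by simpa using hv.2.2.2.2.1 hz⟩

lemma exists_sign_snd (hz : z.2 = 0 ∨ z.2 = 1) :
    ∃ s : ℤ, (s = 1 ∨ s = -1) ∧ ∀ v, AllowedOffset z v → 0 ≤ s * v.2 := by
  rcases hz with hz | hz
  · exact ⟨1, Or.inl rfl, fun v hv => by simpa using hv.2.2.2.2.2.1 hz⟩
  · exact ⟨-1, Or.inr rfl, fun v hv => by simpa using hv.2.2.2.2.2.2 hz⟩

end AllowedOffset

lemma uniqueDigits_of_eq {N : ℕ} {t : ℝ} (ht : t = 0 ∨ t = 1) : UniqueDigits N t :=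
  ht.imp_right Or.inl

namespace SelfSimilar

variable {N : ℕ} {D : Finset (ℕ × ℕ)} {F : Set (ℝ × ℝ)} {z : ℝ × ℝ}

lemma componentsLE_interior (h : SelfSimilar N D F) (hN : 2 ≤ N) (hF : IsCompact F)
    (hconn : IsConnected F) (hz : z ∈ F) (hz1 : UniqueDigits N z.1) (hz2 : UniqueDigits N z.2) :
    ComponentsLE (F \ {z}) 8 :=
  h.componentsLE_of_allowedOffset hN hF hconn hz hz1 hz2 (W := adjacentOffsets)
    (fun _ hv => hv.mem_adjacentOffsets) (Or.inl (by decide))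

lemma componentsLE_vertical_edge (h : SelfSimilar N D F) (hN : 2 ≤ N) (hF : IsCompact F)
    (hconn : IsConnected F) (hz : z ∈ F) (hz1 : z.1 = 0 ∨ z.1 = 1) (hz2 : UniqueDigits N z.2) :
    ComponentsLE (F \ {z}) 4 := by
  obtain ⟨s, hs, hsv⟩ := AllowedOffset.exists_sign_fst hz1
  refine h.componentsLE_of_allowedOffset hN hF hconn hz (uniqueDigits_of_eq hz1) hz2
    (W := adjacentOffsets.filter fun v => 0 ≤ s * v.1)
    (fun v hv => Finset.mem_filter.2 ⟨hv.mem_adjacentOffsets, hsv v hv⟩) (Or.inr ?_)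
  rcases hs with rfl | rfl
  · exact ⟨by decide, (1, 1), by decide, (0, 1), by decide, by decide, by decide⟩
  · exact ⟨by decide, (-1, 1), by decide, (0, 1), by decide, by decide, by decide⟩

lemma componentsLE_horizontal_edge (h : SelfSimilar N D F) (hN : 2 ≤ N) (hF : IsCompact F)
    (hconn : IsConnected F) (hz : z ∈ F) (hz1 : UniqueDigits N z.1) (hz2 : z.2 = 0 ∨ z.2 = 1) :
    ComponentsLE (F \ {z}) 4 := by
  obtain ⟨s, hs, hsv⟩ := AllowedOffset.exists_sign_snd hz2
  refine h.componentsLE_of_allowedOffset hN hF hconn hz hz1 (uniqueDigits_of_eq hz2)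
    (W := adjacentOffsets.filter fun v => 0 ≤ s * v.2)
    (fun v hv => Finset.mem_filter.2 ⟨hv.mem_adjacentOffsets, hsv v hv⟩) (Or.inr ?_)
  rcases hs with rfl | rfl
  · exact ⟨by decide, (1, 1), by decide, (1, 0), by decide, by decide, by decide⟩
  · exact ⟨by decide, (1, -1), by decide, (1, 0), by decide, by decide, by decide⟩

lemma componentsLE_corner (h : SelfSimilar N D F) (hN : 2 ≤ N) (hF : IsCompact F)
    (hconn : IsConnected F) (hz : z ∈ F) (hz1 : z.1 = 0 ∨ z.1 = 1) (hz2 : z.2 = 0 ∨ z.2 = 1) :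
    ComponentsLE (F \ {z}) 2 := by
  obtain ⟨s, hs, hsv⟩ := AllowedOffset.exists_sign_fst hz1
  obtain ⟨t, ht, htv⟩ := AllowedOffset.exists_sign_snd hz2
  refine h.componentsLE_of_allowedOffset hN hF hconn hz (uniqueDigits_of_eq hz1)
    (uniqueDigits_of_eq hz2) (W := adjacentOffsets.filter fun v => 0 ≤ s * v.1 ∧ 0 ≤ t * v.2)
    (fun v hv => Finset.mem_filter.2 ⟨hv.mem_adjacentOffsets, hsv v hv, htv v hv⟩)
    (Or.inr ⟨?_, (s, t), ?_, (s, 0), ?_⟩) <;>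
  rcases hs with rfl | rfl <;> rcases ht with rfl | rfl <;> decide

end SelfSimilar

lemma exists_digits_two (t : ℝ) :
    ∃ B : Finset ℕ, B.card ≤ 2 ∧ ∀ a : ℕ, 0 ≤ t - a ∧ t - a ≤ 1 → a ∈ B := by
  refine ⟨Finset.Icc (⌊t⌋ - 1).toNat ⌊t⌋.toNat, ?_, fun a ha => ?_⟩
  · rw [Nat.card_Icc]
    omega
  · have h1 : (a : ℤ) ≤ ⌊t⌋ := Int.le_floor.2 (by push_cast; linarith [ha.1])
    have h2 : ⌊t⌋ ≤ (a : ℤ) + 1 := by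
      have : (⌊t⌋ : ℝ) ≤ a + 1 := (Int.floor_le t).trans (by linarith [ha.2])
      exact_mod_cast this
    rw [Finset.mem_Icc]
    omega

lemma exists_digits_one {t : ℝ} (ht : ∀ k : ℤ, t ≠ k) :
    ∃ B : Finset ℕ, B.card ≤ 1 ∧ ∀ a : ℕ, 0 ≤ t - a ∧ t - a ≤ 1 → a ∈ B :=
  ⟨{⌊t⌋.toNat}, by simp, fun a ha => by
    rw [Finset.mem_singleton, floor_eq_of_sub_mem ht ha, Int.toNat_natCast]⟩

lemma eq_zero_or_one_of_sub {t u : ℝ} {k : ℤ} {a : ℕ} (ht : t = k) (hu : t - a = u)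
    (hu01 : 0 ≤ u ∧ u ≤ 1) : u = 0 ∨ u = 1 := by
  have huk : u = ((k - a : ℤ) : ℝ) := by
    push_cast
    rw [← hu, ht]
  rw [huk] at hu01 ⊢
  norm_cast at hu01 ⊢
  omega

lemma uniqueDigits_of_sub {N n a : ℕ} {t u : ℝ} (ht : ∀ (m : ℕ) (k : ℤ), (N : ℝ) ^ m * t ≠ k)
    (hu : (N : ℝ) ^ n * t - a = u) : UniqueDigits N u := by
  refine Or.inr (Or.inr fun m k hk => ht (m + n) (k + N ^ m * a) ?_)
  push_cast
  rw [← hk, ← hu]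
  ring

namespace SelfSimilar

variable {N : ℕ} {D : Finset (ℕ × ℕ)} {F : Set (ℝ × ℝ)} {x : ℝ × ℝ}

/-- Bound the components of `F \ {x}` through the cells of level `n` containing `x`. -/
lemma componentsLE_of_level (h : SelfSimilar N D F) (hN : 2 ≤ N) (hF : IsCompact F)
    (hconn : IsConnected F) (hx : x ∈ F) (n : ℕ) {B C : Finset ℕ} {b c K : ℕ}
    (hB : B.card ≤ b) (hC : C.card ≤ c)
    (hBx : ∀ a : ℕ, 0 ≤ (N : ℝ) ^ n * x.1 - a ∧ (N : ℝ) ^ n * x.1 - a ≤ 1 → a ∈ B)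
    (hCx : ∀ a : ℕ, 0 ≤ (N : ℝ) ^ n * x.2 - a ∧ (N : ℝ) ^ n * x.2 - a ≤ 1 → a ∈ C)
    (hK : ∀ d : ℕ × ℕ, ∀ z ∈ F, (N : ℝ) ^ n * x.1 - d.1 = z.1 → (N : ℝ) ^ n * x.2 - d.2 = z.2 →
      ComponentsLE (F \ {z}) K) :
    ComponentsLE (F \ {x}) (b * c * K) := by
  obtain ⟨E, hE⟩ := h.pow (by omega) n
  have hM : 0 < N ^ n := by positivity
  have hM' : (N : ℝ) ^ n ≠ 0 := by positivity
  refine hE.componentsLE_of_cells hM hF hconn hx (A := B ×ˢ C) (fun d _ hxd => ?_) ?_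
    fun d _ z hz hzx => hK d z hz ?_ ?_
  · have := mul_sub_mem_unit hM (fun p hp => h.mem_unit hN hF hp) hxd
    push_cast at this
    exact Finset.mem_product.2 ⟨hBx _ this.1, hCx _ this.2⟩
  · rw [Finset.card_product]
    exact Nat.mul_le_mul hB hC
  all_goals
    rw [← hzx]
    simp only [phi]
    push_cast
    field_simp
    ring

lemma componentsLE_eight (h : SelfSimilar N D F) (hN : 2 ≤ N) (hF : IsCompact F)
    (hconn : IsConnected F) (hx : x ∈ F) : ComponentsLE (F \ {x}) 8 := by
  have hunit := fun p (hp : p ∈ F) => h.mem_unit hN hF hp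
  by_cases h1 : ∃ (n : ℕ) (k : ℤ), (N : ℝ) ^ n * x.1 = k <;>
    by_cases h2 : ∃ (n : ℕ) (k : ℤ), (N : ℝ) ^ n * x.2 = k
  · obtain ⟨n, k, hk⟩ := h1
    obtain ⟨m, l, hl⟩ := h2
    have hk' : (N : ℝ) ^ (n + m) * x.1 = ((N ^ m * k : ℤ) : ℝ) := by
      push_cast
      rw [← hk]
      ring
    have hl' : (N : ℝ) ^ (n + m) * x.2 = ((N ^ n * l : ℤ) : ℝ) := by
      push_cast
      rw [← hl]
      ring
    obtain ⟨B, hB, hBx⟩ := exists_digits_two ((N : ℝ) ^ (n + m) * x.1)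
    obtain ⟨C, hC, hCx⟩ := exists_digits_two ((N : ℝ) ^ (n + m) * x.2)
    exact h.componentsLE_of_level hN hF hconn hx (n + m) hB hC hBx hCx fun d z hz hz1 hz2 =>
      h.componentsLE_corner hN hF hconn hz (eq_zero_or_one_of_sub hk' hz1 (hunit z hz).1)
        (eq_zero_or_one_of_sub hl' hz2 (hunit z hz).2)
  · obtain ⟨n, k, hk⟩ := h1
    push Not at h2
    obtain ⟨B, hB, hBx⟩ := exists_digits_two ((N : ℝ) ^ n * x.1)
    obtain ⟨C, hC, hCx⟩ := exists_digits_one (h2 n)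
    exact h.componentsLE_of_level hN hF hconn hx n hB hC hBx hCx fun d z hz hz1 hz2 =>
      h.componentsLE_vertical_edge hN hF hconn hz
        (eq_zero_or_one_of_sub hk hz1 (hunit z hz).1) (uniqueDigits_of_sub h2 hz2)
  · obtain ⟨n, k, hk⟩ := h2
    push Not at h1
    obtain ⟨B, hB, hBx⟩ := exists_digits_one (h1 n)
    obtain ⟨C, hC, hCx⟩ := exists_digits_two ((N : ℝ) ^ n * x.2)
    exact h.componentsLE_of_level hN hF hconn hx n hB hC hBx hCx fun d z hz hz1 hz2 =>
      h.componentsLE_horizontal_edge hN hF hconn hz (uniqueDigits_of_sub h1 hz1)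
        (eq_zero_or_one_of_sub hk hz2 (hunit z hz).2)
  · push Not at h1 h2
    exact h.componentsLE_interior hN hF hconn hx (Or.inr (Or.inr h1)) (Or.inr (Or.inr h2))

end SelfSimilar

/-- For a connected GSC F and any x ∈ F, the set F \ {x} has at most eight
connected components. -/
theorem stmt5 (N : ℕ) (hN : 2 ≤ N) (D : Finset (ℕ × ℕ))
    (hD : ∀ d ∈ D, d.1 < N ∧ d.2 < N) (hDcard : 1 < D.card ∧ D.card < N ^ 2)
    (F : Set (ℝ × ℝ)) (hFne : F.Nonempty) (hFc : IsCompact F)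
    (hFattr : F = ⋃ d ∈ D, phi N d '' F) (hFconn : IsConnected F)
    (x : ℝ × ℝ) (hx : x ∈ F) :
    ∃ s : Finset (Set (ℝ × ℝ)), s.card ≤ 8 ∧
      ∀ y ∈ F \ {x}, connectedComponentIn (F \ {x}) y ∈ s := by
  classical
  obtain ⟨t, ht, hcover⟩ :=
    (SelfSimilar.mk hD hFattr).componentsLE_eight hN hFc hFconn hx
  refine ⟨t.image (connectedComponentIn (F \ {x})), Finset.card_image_le.trans ht, fun y hy => ?_⟩
  obtain ⟨p, hp, hyp⟩ := hcover y hy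
  exact Finset.mem_image.2 ⟨p, hp, connectedComponentIn_eq hyp⟩
end

section
/- Let F be a connected GSC with 0 < #C_F < ∞, where C_F is the set of cut points. If for some x ∈ C_F all connected components of F \ {x} are vertical, then for every y ∈ C_F all connected components of F \ {y} are vertical (and symmetrically with 'horizontal'). -/
open Set

/-- A set C ⊆ [0,1]² is vertical if it meets both [0,1]×{0} and [0,1]×{1}. -/
def IsVertical (C : Set (ℝ × ℝ)) : Prop :=
  (C ∩ {p | p.2 = 0 ∧ p.1 ∈ Icc (0 : ℝ) 1}).Nonempty ∧
  (C ∩ {p | p.2 = 1 ∧ p.1 ∈ Icc (0 : ℝ) 1}).Nonempty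

/-- A set C ⊆ [0,1]² is horizontal if it meets both {0}×[0,1] and {1}×[0,1]. -/
def IsHorizontal (C : Set (ℝ × ℝ)) : Prop :=
  (C ∩ {p | p.1 = 0 ∧ p.2 ∈ Icc (0 : ℝ) 1}).Nonempty ∧
  (C ∩ {p | p.1 = 1 ∧ p.2 ∈ Icc (0 : ℝ) 1}).Nonempty

/-- An angle function which stays in the lower half-turn and ends in the left half-turn
advances to the next quadrant (clockwise). -/
lemma quarter_turn {f : ℝ → ℝ} (hf : Continuous f) (hsin : ∀ t ∈ Icc (0 : ℝ) 1, Real.sin (f t) ≤ 0)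
    (h0 : f 0 ∈ Icc (-(Real.pi / 2)) 0) (hcos : Real.cos (f 1) ≤ 0) :
    f 1 + Real.pi / 2 ∈ Icc (-(Real.pi / 2)) 0 := by
  have hpi := Real.pi_pos
  obtain ⟨h0l, h0u⟩ := h0
  have hle : f 1 ≤ 0 := by
    by_contra! hlt
    have hmem : min (f 1) (Real.pi / 2) ∈ Icc (f 0) (f 1) :=
      ⟨le_min (by linarith) (by linarith), min_le_left _ _⟩
    obtain ⟨t, ht, hft⟩ := intermediate_value_Icc zero_le_one hf.continuousOn hmem
    have hs := hsin t ht
    rw [hft] at hs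
    have hpos : 0 < min (f 1) (Real.pi / 2) := lt_min hlt (by linarith)
    have := Real.sin_pos_of_pos_of_lt_pi hpos (by linarith [min_le_right (f 1) (Real.pi / 2)])
    linarith
  have hge : -Real.pi ≤ f 1 := by
    by_contra! hlt
    have hmem : max (f 1) (-(3 * Real.pi / 2)) ∈ Icc (f 1) (f 0) :=
      ⟨le_max_left _ _, max_le (by linarith) (by linarith)⟩
    obtain ⟨t, ht, hft⟩ := intermediate_value_Icc' zero_le_one hf.continuousOn hmem
    have hs := hsin t ht
    rw [hft] at hs
    have hneg : max (f 1) (-(3 * Real.pi / 2)) < -Real.pi := max_lt hlt (by linarith)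
    have := Real.sin_pos_of_pos_of_lt_pi
      (x := max (f 1) (-(3 * Real.pi / 2)) + 2 * Real.pi)
      (by linarith [le_max_right (f 1) (-(3 * Real.pi / 2))]) (by linarith)
    rw [Real.sin_add_two_pi] at this
    linarith
  refine ⟨by linarith, ?_⟩
  by_contra! hlt
  have := Real.cos_pos_of_mem_Ioo (x := f 1) ⟨by linarith, ?_⟩
  · linarith
  · linarith

/-- A continuous path joining the bottom side to the top side of the unit square meets every
continuous path joining the left side to the right side. -/
lemma exists_path_crossing {α β : ℝ → ℝ × ℝ} (hα : Continuous α) (hβ : Continuous β)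
    (hαI : ∀ t, α t ∈ Icc ((0 : ℝ), (0 : ℝ)) (1, 1)) (hβI : ∀ t, β t ∈ Icc ((0 : ℝ), (0 : ℝ)) (1, 1))
    (hα0 : (α 0).2 = 0) (hα1 : (α 1).2 = 1) (hβ0 : (β 0).1 = 0) (hβ1 : (β 1).1 = 1) :
    ∃ s t, α s = β t := by
  by_contra! hne
  let g : C(ℝ × ℝ, ℂ) :=
    ⟨fun p => ⟨(α p.1).1 - (β p.2).1, (α p.1).2 - (β p.2).2⟩, by
      have : (fun p : ℝ × ℝ => (⟨(α p.1).1 - (β p.2).1, (α p.1).2 - (β p.2).2⟩ : ℂ)) =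
          fun p : ℝ × ℝ => (((α p.1).1 - (β p.2).1 : ℝ) : ℂ) +
            (((α p.1).2 - (β p.2).2 : ℝ) : ℂ) * Complex.I := by
        funext p
        apply Complex.ext <;> simp
      rw [this]
      fun_prop⟩
  have hgre (s t : ℝ) : (g (s, t)).re = (α s).1 - (β t).1 := rfl
  have hgim (s t : ℝ) : (g (s, t)).im = (α s).2 - (β t).2 := rfl
  have hg0 (p : ℝ × ℝ) : g p ≠ 0 := by
    intro h
    apply hne p.1 p.2
    have h1 := congrArg Complex.re h
    have h2 := congrArg Complex.im h
    rw [hgre p.1 p.2] at h1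
    rw [hgim p.1 p.2] at h2
    simp only [Complex.zero_re, Complex.zero_im] at h1 h2
    exact Prod.ext (by linarith) (by linarith)
  obtain ⟨L, ⟨hL0, hL⟩, -⟩ := Complex.isCoveringMapOn_exp.existsUnique_continuousMap_lifts g
    (Complex.exp_log (hg0 (0, 0))) (fun p => hg0 p)
  have hexp (p : ℝ × ℝ) : Complex.exp (L p) = g p := congrFun hL p
  have hre (p : ℝ × ℝ) : (g p).re = Real.exp (L p).re * Real.cos (L p).im := by
    rw [← hexp, Complex.exp_re]
  have him (p : ℝ × ℝ) : (g p).im = Real.exp (L p).re * Real.sin (L p).im := by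
    rw [← hexp, Complex.exp_im]
  have hcos_nonpos (s t : ℝ) (h : (α s).1 ≤ (β t).1) : Real.cos (L (s, t)).im ≤ 0 := by
    have := hre (s, t)
    rw [hgre] at this
    exact nonpos_of_mul_nonpos_right (by linarith) (Real.exp_pos _)
  have hcos_nonneg (s t : ℝ) (h : (β t).1 ≤ (α s).1) : 0 ≤ Real.cos (L (s, t)).im := by
    have := hre (s, t)
    rw [hgre] at this
    exact nonneg_of_mul_nonneg_right (by linarith) (Real.exp_pos _)
  have hsin_nonpos (s t : ℝ) (h : (α s).2 ≤ (β t).2) : Real.sin (L (s, t)).im ≤ 0 := by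
    have := him (s, t)
    rw [hgim] at this
    exact nonpos_of_mul_nonpos_right (by linarith) (Real.exp_pos _)
  have hsin_nonneg (s t : ℝ) (h : (β t).2 ≤ (α s).2) : 0 ≤ Real.sin (L (s, t)).im := by
    have := him (s, t)
    rw [hgim] at this
    exact nonneg_of_mul_nonneg_right (by linarith) (Real.exp_pos _)
  have hstart : (L (0, 0)).im ∈ Icc (-(Real.pi / 2)) 0 := by
    have harg : (L (0, 0)).im = (g (0, 0)).arg := by rw [hL0, Complex.log_im]
    have habs : |(g (0, 0)).arg| ≤ Real.pi / 2 := by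
      rw [Complex.abs_arg_le_pi_div_two_iff, hgre]
      linarith [(hαI 0).1.1]
    rw [abs_le, ← harg] at habs
    refine ⟨habs.1, ?_⟩
    by_contra! hpos
    have := Real.sin_pos_of_pos_of_lt_pi hpos (by linarith [Real.pi_pos])
    linarith [hsin_nonpos 0 0 (by linarith [(hβI 0).1.2])]
  have hbottom := quarter_turn (f := fun t => (L (0, t)).im) (by fun_prop)
    (fun t _ => hsin_nonpos 0 t (by rw [hα0]; exact (hβI t).1.2)) hstart
    (hcos_nonpos 0 1 (by rw [hβ1]; exact (hαI 0).2.1))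
  have hright := quarter_turn (f := fun s => (L (s, 1)).im + Real.pi / 2) (by fun_prop)
    (fun s _ => by
      rw [Real.sin_add_pi_div_two]
      exact hcos_nonpos s 1 (by rw [hβ1]; exact (hαI s).2.1)) hbottom
    (by
      rw [Real.cos_add_pi_div_two]
      linarith [hsin_nonneg 1 1 (by rw [hα1]; exact (hβI 1).2.2)])
  have htop := quarter_turn
    (f := fun t => (L (1, 1 - t)).im + Real.pi / 2 + Real.pi / 2) (by fun_prop)
    (fun t _ => by
      rw [Real.sin_add_pi_div_two, Real.cos_add_pi_div_two]
      linarith [hsin_nonneg 1 (1 - t) (by rw [hα1]; exact (hβI _).2.2)])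
    (by simpa using hright)
    (by
      rw [Real.cos_add_pi_div_two, Real.sin_add_pi_div_two, sub_self]
      linarith [hcos_nonneg 1 0 (by rw [hβ0]; exact (hαI 1).1.1)])
  have hleft := quarter_turn
    (f := fun s => (L (1 - s, 0)).im + Real.pi / 2 + Real.pi / 2 + Real.pi / 2) (by fun_prop)
    (fun s _ => by
      rw [Real.sin_add_pi_div_two, Real.cos_add_pi_div_two, Real.sin_add_pi_div_two]
      linarith [hcos_nonneg (1 - s) 0 (by rw [hβ0]; exact (hαI _).1.1)])
    (by simpa using htop)
    (by
      rw [Real.cos_add_pi_div_two, Real.sin_add_pi_div_two, Real.cos_add_pi_div_two, sub_self]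
      linarith [hsin_nonpos 0 0 (by rw [hα0]; exact (hβI 0).1.2)])
  simp only [sub_self] at hleft
  linarith [hleft.2, hstart.1, Real.pi_pos]

lemma IsConnected.thickening {E : Type*} [SeminormedAddCommGroup E] [NormedSpace ℝ E] {K : Set E}
    (hK : IsConnected K) {δ : ℝ} (hδ : 0 < δ) : IsConnected (Metric.thickening δ K) := by
  rw [← add_ball_zero δ K, ← Set.image2_add, ← Set.image_prod]
  exact (hK.prod ((convex_ball (0 : E) δ).isConnected ⟨0, Metric.mem_ball_self hδ⟩)).image _
    continuous_add.continuousOn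

/-- A point of a thickening of a subset of the unit square may be moved into the square. -/
noncomputable def clampSquare (p : ℝ × ℝ) : ℝ × ℝ := (max (min p.1 1) 0, max (min p.2 1) 0)

lemma continuous_clampSquare : Continuous clampSquare := by
  unfold clampSquare
  fun_prop

lemma clampSquare_mem (p : ℝ × ℝ) : clampSquare p ∈ Icc ((0 : ℝ), (0 : ℝ)) (1, 1) := by
  simp [clampSquare, Prod.le_def]

lemma clampSquare_eq_self {p : ℝ × ℝ} (hp : p ∈ Icc ((0 : ℝ), (0 : ℝ)) (1, 1)) :
    clampSquare p = p := by
  obtain ⟨⟨h1, h2⟩, h3, h4⟩ := hp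
  simp only at h1 h2 h3 h4
  simp [clampSquare, h1, h2, h3, h4]

lemma dist_clampSquare_le (p q : ℝ × ℝ) : dist (clampSquare p) (clampSquare q) ≤ dist p q := by
  have key (a b : ℝ) : dist (max (min a 1) 0) (max (min b 1) 0) ≤ dist a b := by
    rw [Real.dist_eq, Real.dist_eq]
    exact (abs_max_sub_max_le_abs _ _ _).trans
      (abs_inf_sub_inf_le_abs _ _ _)
  rw [Prod.dist_eq, Prod.dist_eq]
  exact max_le_max (key _ _) (key _ _)

lemma clampSquare_mem_thickening {K : Set (ℝ × ℝ)} (hK : K ⊆ Icc (0, 0) (1, 1)) {δ : ℝ}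
    {p : ℝ × ℝ} (hp : p ∈ Metric.thickening δ K) : clampSquare p ∈ Metric.thickening δ K := by
  rw [Metric.mem_thickening_iff] at hp ⊢
  obtain ⟨k, hk, hkp⟩ := hp
  refine ⟨k, hk, lt_of_le_of_lt ?_ hkp⟩
  simpa [clampSquare_eq_self (hK hk)] using dist_clampSquare_le p k

lemma exists_path_in_thickening {K : Set (ℝ × ℝ)} (hconn : IsConnected K)
    (hK : K ⊆ Icc (0, 0) (1, 1)) {δ : ℝ} (hδ : 0 < δ) {a b : ℝ × ℝ} (ha : a ∈ K) (hb : b ∈ K) :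
    ∃ γ : ℝ → ℝ × ℝ, Continuous γ ∧ (∀ t, γ t ∈ Icc ((0 : ℝ), (0 : ℝ)) (1, 1)) ∧
      (∀ t, γ t ∈ Metric.thickening δ K) ∧ γ 0 = a ∧ γ 1 = b := by
  have hpath := (Metric.isOpen_thickening.isConnected_iff_isPathConnected).1 (hconn.thickening hδ)
  obtain ⟨γ, hγ⟩ := hpath.joinedIn a (Metric.self_subset_thickening hδ K ha) b
    (Metric.self_subset_thickening hδ K hb)
  refine ⟨fun t => clampSquare (γ.extend t), continuous_clampSquare.comp γ.continuous_extend,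
    fun t => clampSquare_mem _, fun t => clampSquare_mem_thickening hK ?_, ?_, ?_⟩
  · exact hγ _
  · simp [clampSquare_eq_self (hK ha)]
  · simp [clampSquare_eq_self (hK hb)]

/-- A vertical and a horizontal continuum in the unit square intersect. -/
lemma vertical_inter_horizontal {K M : Set (ℝ × ℝ)} (hKc : IsCompact K) (hMc : IsCompact M)
    (hK : IsConnected K) (hM : IsConnected M) (hKI : K ⊆ Icc (0, 0) (1, 1))
    (hMI : M ⊆ Icc (0, 0) (1, 1)) (hKv : IsVertical K) (hMh : IsHorizontal M) :
    ¬ Disjoint K M := by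
  intro hdisj
  obtain ⟨δ, hδ, hthick⟩ := hdisj.exists_thickenings hKc hMc.isClosed
  obtain ⟨⟨a, haK, ha, -⟩, b, hbK, hb, -⟩ := hKv
  obtain ⟨⟨c, hcM, hc, -⟩, d, hdM, hd, -⟩ := hMh
  obtain ⟨α, hαc, hαI, hα, rfl, rfl⟩ := exists_path_in_thickening hK hKI hδ haK hbK
  obtain ⟨β, hβc, hβI, hβ, rfl, rfl⟩ := exists_path_in_thickening hM hMI hδ hcM hdM
  obtain ⟨s, t, hst⟩ := exists_path_crossing hαc hβc hαI hβI ha hb hc hd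
  exact Set.disjoint_left.1 hthick (hα s) (hst ▸ hβ t)

lemma closure_connectedComponentIn_inter_subset {X : Type*} [TopologicalSpace X] {s : Set X}
    {z : X} : closure (connectedComponentIn s z) ∩ s ⊆ connectedComponentIn s z := by
  by_cases hz : z ∈ s
  · refine IsPreconnected.subset_connectedComponentIn ?_ ?_ inter_subset_right
    · exact isPreconnected_connectedComponentIn.subset_closure
        (subset_inter subset_closure (connectedComponentIn_subset _ _)) inter_subset_left
    · exact ⟨subset_closure (mem_connectedComponentIn hz), hz⟩
  · simp [connectedComponentIn_eq_empty hz]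

/-- The similarity `phi N d` as a homeomorphism of the plane. -/
noncomputable def phiHomeomorph (N : ℕ) (hN : N ≠ 0) (d : ℕ × ℕ) : ℝ × ℝ ≃ₜ ℝ × ℝ where
  toFun := phi N d
  invFun p := (N * p.1 - d.1, N * p.2 - d.2)
  left_inv p := by
    have : (N : ℝ) ≠ 0 := by exact_mod_cast hN
    ext <;> simp only [phi] <;> field_simp <;> ring
  right_inv p := by
    have : (N : ℝ) ≠ 0 := by exact_mod_cast hN
    ext <;> simp only [phi] <;> field_simp <;> ring
  continuous_toFun := by
    change Continuous fun p : ℝ × ℝ => ((p.1 + d.1) / (N : ℝ), (p.2 + d.2) / (N : ℝ))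
    fun_prop
  continuous_invFun := by fun_prop

lemma dist_phi (N : ℕ) (d : ℕ × ℕ) (p q : ℝ × ℝ) :
    dist (phi N d p) (phi N d q) = dist p q / N := by
  have key (a b c : ℝ) : dist ((a + c) / N) ((b + c) / N) = dist a b / N := by
    rw [Real.dist_eq, Real.dist_eq, ← sub_div, abs_div, Nat.abs_cast]
    ring_nf
  rw [Prod.dist_eq, Prod.dist_eq]
  simp only [phi, key]
  exact (max_div_div_right (Nat.cast_nonneg N) _ _)

lemma phi_eq_phi_iff {N : ℕ} (hN : N ≠ 0) {d e : ℕ × ℕ} {p q : ℝ × ℝ} :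
    phi N d p = phi N e q ↔ p.1 + d.1 = q.1 + e.1 ∧ p.2 + d.2 = q.2 + e.2 := by
  have : (N : ℝ) ≠ 0 := by exact_mod_cast hN
  simp [phi, Prod.ext_iff, div_left_inj' this]

/-- A connected generalized Sierpiński carpet with finitely many cut points. -/
structure IsCarpet (N : ℕ) (D : Finset (ℕ × ℕ)) (F : Set (ℝ × ℝ)) : Prop where
  two_le : 2 ≤ N
  lt : ∀ d ∈ D, d.1 < N ∧ d.2 < N
  compact : IsCompact F
  attr : F = ⋃ d ∈ D, phi N d '' F
  conn : IsConnected F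
  sub : F ⊆ Icc (0, 0) (1, 1)
  fin : {y : ℝ × ℝ | y ∈ F ∧ ¬ IsPreconnected (F \ {y})}.Finite

/-- The set meets the right side or the top side of the unit square. -/
def MeetsTopRight (C : Set (ℝ × ℝ)) : Prop := ∃ p ∈ C, p.1 = 1 ∨ p.2 = 1

/-- No digit of `D` is an immediate left, lower or lower left neighbour of `d`. -/
def IsCornerDigit (D : Finset (ℕ × ℕ)) (d : ℕ × ℕ) : Prop :=
  d ∈ D ∧ ∀ e ∈ D, e.1 ≤ d.1 → d.1 ≤ e.1 + 1 → e.2 ≤ d.2 → d.2 ≤ e.2 + 1 → e = d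

namespace IsCarpet

variable {N : ℕ} {D : Finset (ℕ × ℕ)} {F : Set (ℝ × ℝ)}

lemma ne_zero (h : IsCarpet N D F) : N ≠ 0 := by
  have := h.two_le
  omega

lemma phi_mem (h : IsCarpet N D F) {d : ℕ × ℕ} (hd : d ∈ D) {p : ℝ × ℝ} (hp : p ∈ F) :
    phi N d p ∈ F := by
  rw [h.attr]
  exact mem_biUnion hd (mem_image_of_mem _ hp)

lemma exists_phi_eq (h : IsCarpet N D F) {p : ℝ × ℝ} (hp : p ∈ F) :
    ∃ d ∈ D, ∃ q ∈ F, phi N d q = p := by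
  rw [h.attr] at hp
  simpa using hp

lemma phi_injective (h : IsCarpet N D F) (d : ℕ × ℕ) : Function.Injective (phi N d) :=
  (phiHomeomorph N h.ne_zero d).injective

lemma continuous_phi (h : IsCarpet N D F) (d : ℕ × ℕ) : Continuous (phi N d) :=
  (phiHomeomorph N h.ne_zero d).continuous

lemma isClosed_cell (h : IsCarpet N D F) (d : ℕ × ℕ) : IsClosed (phi N d '' F) :=
  (h.compact.image (h.continuous_phi d)).isClosed

lemma isConnected_cell (h : IsCarpet N D F) (d : ℕ × ℕ) : IsConnected (phi N d '' F) :=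
  h.conn.image _ (h.continuous_phi d).continuousOn

lemma dist_le_one (h : IsCarpet N D F) {p q : ℝ × ℝ} (hp : p ∈ F) (hq : q ∈ F) :
    dist p q ≤ 1 := by
  obtain ⟨⟨h1, h2⟩, h3, h4⟩ := h.sub hp
  obtain ⟨⟨h5, h6⟩, h7, h8⟩ := h.sub hq
  simp only at h1 h2 h3 h4 h5 h6 h7 h8
  rw [Prod.dist_eq, Real.dist_eq, Real.dist_eq]
  exact max_le (abs_le.2 ⟨by linarith, by linarith⟩) (abs_le.2 ⟨by linarith, by linarith⟩)

/-- The carpet is a finite union of arbitrarily small continua. -/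
lemma exists_small_pieces (h : IsCarpet N D F) (n : ℕ) :
    ∃ 𝒦 : Set (Set (ℝ × ℝ)), 𝒦.Finite ∧ ⋃₀ 𝒦 = F ∧ ∀ K ∈ 𝒦, IsCompact K ∧ IsConnected K ∧
      ∀ p ∈ K, ∀ q ∈ K, dist p q ≤ (1 / (N : ℝ)) ^ n := by
  induction n with
  | zero =>
    refine ⟨{F}, finite_singleton F, sUnion_singleton F, ?_⟩
    rintro K rfl
    exact ⟨h.compact, h.conn, fun p hp q hq => by simpa using h.dist_le_one hp hq⟩
  | succ n ih =>
    obtain ⟨𝒦, hfin, hcover, hK⟩ := ih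
    refine ⟨image2 (fun d K => phi N d '' K) D 𝒦, D.finite_toSet.image2 _ hfin, ?_, ?_⟩
    · ext p
      constructor
      · rintro ⟨_, ⟨d, hd, K, hK𝒦, rfl⟩, q, hq, rfl⟩
        exact h.phi_mem hd (hcover ▸ mem_sUnion_of_mem hq hK𝒦)
      · intro hp
        obtain ⟨d, hd, q, hq, rfl⟩ := h.exists_phi_eq hp
        rw [← hcover] at hq
        obtain ⟨K, hK𝒦, hqK⟩ := hq
        exact ⟨_, ⟨d, hd, K, hK𝒦, rfl⟩, mem_image_of_mem _ hqK⟩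
    · rintro _ ⟨d, hd, K, hK𝒦, rfl⟩
      obtain ⟨hc, hconn, hdist⟩ := hK K hK𝒦
      refine ⟨hc.image (h.continuous_phi d), hconn.image _ (h.continuous_phi d).continuousOn, ?_⟩
      rintro _ ⟨p, hp, rfl⟩ _ ⟨q, hq, rfl⟩
      rw [dist_phi, pow_succ, mul_one_div]
      exact div_le_div_of_nonneg_right (hdist p hp q hq) (Nat.cast_nonneg N)

lemma inv_lt_one (h : IsCarpet N D F) : 1 / (N : ℝ) < 1 := by
  have : (2 : ℝ) ≤ N := by exact_mod_cast h.two_le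
  rw [div_lt_one] <;> linarith

/-- Components of a punctured carpet are relatively open. -/
lemma exists_isOpen_inter_subset_component (h : IsCarpet N D F) {x z p : ℝ × ℝ}
    (hp : p ∈ connectedComponentIn (F \ {x}) z) :
    ∃ U, IsOpen U ∧ p ∈ U ∧ U ∩ F ⊆ connectedComponentIn (F \ {x}) z := by
  have hpX := connectedComponentIn_subset _ _ hp
  have hdist : 0 < dist x p := dist_pos.2 fun hxp => hpX.2 hxp.symm
  obtain ⟨n, hn⟩ := exists_pow_lt_of_lt_one hdist h.inv_lt_one
  obtain ⟨𝒦, hfin, hcover, hK⟩ := h.exists_small_pieces n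
  refine ⟨(⋃₀ {K ∈ 𝒦 | p ∉ K})ᶜ, ?_, ?_, ?_⟩
  · rw [isOpen_compl_iff, sUnion_eq_biUnion]
    exact (hfin.subset (sep_subset _ _)).isClosed_biUnion fun K hK' => (hK K hK'.1).1.isClosed
  · rintro ⟨K, hK', hpK⟩
    exact hK'.2 hpK
  · rintro q ⟨hqU, hqF⟩
    obtain ⟨K, hK𝒦, hqK⟩ : q ∈ ⋃₀ 𝒦 := hcover ▸ hqF
    have hpK : p ∈ K := by
      by_contra hpK
      exact hqU ⟨K, ⟨hK𝒦, hpK⟩, hqK⟩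
    rw [connectedComponentIn_eq hp]
    refine (hK K hK𝒦).2.1.isPreconnected.subset_connectedComponentIn hpK ?_ hqK
    intro r hr
    refine ⟨hcover ▸ mem_sUnion_of_mem hr hK𝒦, ?_⟩
    rintro rfl
    exact absurd ((hK K hK𝒦).2.2 r hr p hpK) (not_le.2 hn)

/-- At a corner digit, a component missing the top and right sides is copied onto a full
component. -/
lemma component_phi_subset (h : IsCarpet N D F) {x z : ℝ × ℝ} {d : ℕ × ℕ}
    (hd : IsCornerDigit D d) (hz : z ∈ F \ {x})
    (hA : ¬ MeetsTopRight (connectedComponentIn (F \ {x}) z)) :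
    connectedComponentIn (F \ {phi N d x}) (phi N d z) ⊆
      phi N d '' connectedComponentIn (F \ {x}) z := by
  set A := connectedComponentIn (F \ {x}) z with hAdef
  have hAF : A ⊆ F \ {x} := connectedComponentIn_subset _ _
  have hzA : z ∈ A := mem_connectedComponentIn hz
  have hisol : ∀ a ∈ A, ∀ e ∈ D, phi N d a ∈ phi N e '' F → e = d := by
    rintro a ha e he ⟨b, hb, hba⟩
    obtain ⟨h1, h2⟩ := (phi_eq_phi_iff h.ne_zero).1 hba
    obtain ⟨⟨a1, a2⟩, a3, a4⟩ := h.sub (hAF ha).1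
    obtain ⟨⟨b1, b2⟩, b3, b4⟩ := h.sub hb
    simp only at a1 a2 a3 a4 b1 b2 b3 b4
    have a5 : a.1 < 1 := lt_of_le_of_ne a3 fun h' => hA ⟨a, ha, Or.inl h'⟩
    have a6 : a.2 < 1 := lt_of_le_of_ne a4 fun h' => hA ⟨a, ha, Or.inr h'⟩
    have e1 : (e.1 : ℝ) < (d.1 + 1 : ℕ) := by push_cast; linarith
    have e2 : (e.2 : ℝ) < (d.2 + 1 : ℕ) := by push_cast; linarith
    have e3 : (d.1 : ℝ) ≤ (e.1 + 1 : ℕ) := by push_cast; linarith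
    have e4 : (d.2 : ℝ) ≤ (e.2 + 1 : ℕ) := by push_cast; linarith
    exact hd.2 e he (Nat.lt_succ_iff.1 (Nat.cast_lt.1 e1)) (Nat.cast_le.1 e3)
      (Nat.lt_succ_iff.1 (Nat.cast_lt.1 e2)) (Nat.cast_le.1 e4)
  choose! O hOopen hOmem hOsub using
    fun p (hp : p ∈ A) => h.exists_isOpen_inter_subset_component hp
  let U : Set (ℝ × ℝ) :=
    (phi N d '' ⋃ p ∈ A, O p) ∩ (⋃ e ∈ (D.erase d : Finset (ℕ × ℕ)), phi N e '' F)ᶜ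
  let V : Set (ℝ × ℝ) := (phi N d '' closure A)ᶜ
  have hUopen : IsOpen U := by
    refine IsOpen.inter ?_ ?_
    · exact (phiHomeomorph N h.ne_zero d).isOpenMap _ (isOpen_biUnion fun p hp => hOopen p hp)
    · rw [isOpen_compl_iff]
      exact (D.erase d).finite_toSet.isClosed_biUnion fun e _ => h.isClosed_cell e
  have hVopen : IsOpen V := by
    rw [isOpen_compl_iff]
    exact (phiHomeomorph N h.ne_zero d).isClosedMap _ isClosed_closure
  have hAU : phi N d '' A ⊆ U := by
    rintro _ ⟨a, ha, rfl⟩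
    refine ⟨mem_image_of_mem _ (mem_biUnion ha (hOmem a ha)), ?_⟩
    simp only [mem_compl_iff, mem_iUnion, not_exists]
    intro e he hmem
    exact (Finset.mem_erase.1 he).1 (hisol a ha e (Finset.mem_erase.1 he).2 hmem)
  have hUA : F ∩ U ⊆ phi N d '' A := by
    rintro p ⟨hpF, ⟨q, hq, rfl⟩, hpU⟩
    obtain ⟨a, ha, hqa⟩ := mem_iUnion₂.1 hq
    obtain ⟨e, he, b, hb, hbq⟩ := h.exists_phi_eq hpF
    obtain rfl : e = d := by
      by_contra hne
      exact hpU (mem_biUnion (Finset.mem_erase.2 ⟨hne, he⟩) ⟨b, hb, hbq⟩)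
    obtain rfl := h.phi_injective _ hbq
    exact mem_image_of_mem _ (hOsub a ha ⟨hqa, hb⟩)
  have hcover : connectedComponentIn (F \ {phi N d x}) (phi N d z) ⊆ U ∪ V := by
    intro p hp
    have hpF := connectedComponentIn_subset _ _ hp
    by_cases hpV : p ∈ V
    · exact Or.inr hpV
    · left
      obtain ⟨a, ha, rfl⟩ := not_not.1 hpV
      have haF : a ∈ F := h.compact.isClosed.closure_subset_iff.2 (hAF.trans sdiff_subset) ha
      refine hAU (mem_image_of_mem _ (closure_connectedComponentIn_inter_subset ⟨ha, haF, ?_⟩))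
      rintro rfl
      exact hpF.2 rfl
  have hstart : phi N d z ∈ connectedComponentIn (F \ {phi N d x}) (phi N d z) :=
    mem_connectedComponentIn ⟨h.phi_mem hd.1 hz.1, fun hxz => hz.2 (h.phi_injective d hxz)⟩
  intro p hp
  by_contra hpA
  have hpV : p ∈ V := (hcover hp).resolve_left fun hpU =>
    hpA (hUA ⟨(connectedComponentIn_subset _ _ hp).1, hpU⟩)
  obtain ⟨q, hq, hqU, hqV⟩ := isPreconnected_connectedComponentIn U V hUopen hVopen hcover
    ⟨_, hstart, hAU (mem_image_of_mem _ hzA)⟩ ⟨p, hp, hpV⟩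
  exact hqV (image_mono subset_closure (hUA ⟨(connectedComponentIn_subset _ _ hq).1, hqU⟩))

/-- The cut points `y` such that some component of `F \ {y}` misses the top and right sides. -/
def cornerCutPoints (F : Set (ℝ × ℝ)) : Set (ℝ × ℝ) :=
  {y | (y ∈ F ∧ ¬ IsPreconnected (F \ {y})) ∧
    ∃ z ∈ F \ {y}, ¬ MeetsTopRight (connectedComponentIn (F \ {y}) z)}

lemma phi_mem_cornerCutPoints (h : IsCarpet N D F) {d : ℕ × ℕ} (hd : IsCornerDigit D d)
    {x : ℝ × ℝ} (hx : x ∈ cornerCutPoints F) : phi N d x ∈ cornerCutPoints F := by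
  obtain ⟨⟨hxF, hcut⟩, z, hz, hA⟩ := hx
  have hsub := h.component_phi_subset hd hz hA
  have hmaps {w : ℝ × ℝ} (hw : w ∈ F \ {x}) : phi N d w ∈ F \ {phi N d x} :=
    ⟨h.phi_mem hd.1 hw.1, fun hxw => hw.2 (h.phi_injective d hxw)⟩
  refine ⟨⟨h.phi_mem hd.1 hxF, fun hpre => hcut ?_⟩, phi N d z, hmaps hz, ?_⟩
  · have hall : F \ {x} ⊆ connectedComponentIn (F \ {x}) z := by
      intro w hw
      obtain ⟨a, ha, haw⟩ :=
        hsub (hpre.subset_connectedComponentIn (hmaps hz) Subset.rfl (hmaps hw))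
      exact h.phi_injective d haw ▸ ha
    rw [hall.antisymm (connectedComponentIn_subset _ _)]
    exact isPreconnected_connectedComponentIn
  · rintro ⟨p, hp, hp1⟩
    obtain ⟨a, ha, rfl⟩ := hsub hp
    obtain ⟨-, a3, a4⟩ := h.sub (connectedComponentIn_subset _ _ ha).1
    simp only at a3 a4
    have hN : (0 : ℝ) < N := by exact_mod_cast Nat.pos_of_ne_zero h.ne_zero
    obtain ⟨hd1, hd2⟩ := h.lt d hd.1
    have hd1' : (d.1 : ℝ) + 1 ≤ N := by exact_mod_cast hd1
    have hd2' : (d.2 : ℝ) + 1 ≤ N := by exact_mod_cast hd2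
    refine hA ⟨a, ha, ?_⟩
    simp only [phi, div_eq_one_iff_eq hN.ne'] at hp1
    rcases hp1 with hp1 | hp1
    · exact Or.inl (by linarith)
    · exact Or.inr (by linarith)

lemma phi_eq_self_of_mem_cornerCutPoints (h : IsCarpet N D F) {d : ℕ × ℕ}
    (hd : IsCornerDigit D d) {x : ℝ × ℝ} (hx : x ∈ cornerCutPoints F) : phi N d x = x := by
  have hN : (2 : ℝ) ≤ N := by exact_mod_cast h.two_le
  obtain ⟨c, hc⟩ : ∃ c, phi N d c = c := by
    refine ⟨(d.1 / (N - 1), d.2 / (N - 1)), ?_⟩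
    have h0 : (N : ℝ) ≠ 0 := by linarith
    have h1 : (N : ℝ) - 1 ≠ 0 := by linarith
    ext <;> simp only [phi] <;> field_simp <;> ring
  suffices hxc : x = c by rw [hxc, hc]
  by_contra hxc
  have hfin : (cornerCutPoints F \ {c}).Finite := h.fin.subset fun y hy => hy.1.1
  obtain ⟨p, ⟨hp, hpc⟩, hmin⟩ := exists_min_image _ (fun p => dist p c) hfin ⟨x, hx, hxc⟩
  have hpc' : 0 < dist p c := dist_pos.2 hpc
  have hlt : dist (phi N d p) c < dist p c := by
    nth_rewrite 1 [← hc]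
    rw [dist_phi]
    exact div_lt_self hpc' (by linarith)
  refine absurd (hmin _ ⟨h.phi_mem_cornerCutPoints hd hp, fun hpd => hpc ?_⟩) (not_le.2 hlt)
  exact h.phi_injective d ((mem_singleton_iff.1 hpd).trans hc.symm)

lemma exists_isCornerDigit (h : IsCarpet N D F) : ∃ d, IsCornerDigit D d := by
  obtain ⟨p, hp⟩ := h.conn.nonempty
  obtain ⟨d₁, hd₁, -⟩ := h.exists_phi_eq hp
  obtain ⟨d, hd, hmin⟩ := D.exists_min_image (fun d => d.1 + d.2) ⟨d₁, hd₁⟩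
  refine ⟨d, hd, fun e he h1 _ h2 _ => ?_⟩
  have := hmin e he
  ext <;> omega

lemma le_of_unique_cornerDigit {d₀ : ℕ × ℕ} (huniq : ∀ d, IsCornerDigit D d → d = d₀) (n : ℕ) :
    ∀ d ∈ D, d.1 + d.2 = n → d₀.1 ≤ d.1 ∧ d₀.2 ≤ d.2 := by
  induction n using Nat.strong_induction_on with
  | _ n ih =>
    intro d hd hn
    by_cases hcorner : IsCornerDigit D d
    · simp [huniq d hcorner]
    · simp only [IsCornerDigit, not_and, not_forall] at hcorner
      obtain ⟨e, he, h1, h2, h3, h4, hne⟩ := hcorner hd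
      have hlt : e.1 + e.2 < n := by
        by_contra! hge
        exact hne (Prod.ext (by omega) (by omega))
      have := ih _ hlt e he rfl
      omega

lemma fst_eq_one (h : IsCarpet N D F) (hD : ∀ d ∈ D, d.1 + 1 = N) {p : ℝ × ℝ} (hp : p ∈ F) :
    p.1 = 1 := by
  obtain ⟨m, hm, hmin⟩ := h.compact.exists_isMinOn h.conn.nonempty continuous_fst.continuousOn
  obtain ⟨d, hd, q, hq, rfl⟩ := h.exists_phi_eq hm
  have hN : (2 : ℝ) ≤ N := by exact_mod_cast h.two_le
  have hdN : (d.1 : ℝ) + 1 = N := by exact_mod_cast hD d hd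
  have h1 : (q.1 + d.1) / N ≤ q.1 := hmin hq
  have h2 : (q.1 + d.1) / N ≤ p.1 := hmin hp
  have h3 : p.1 ≤ 1 := (h.sub hp).2.1
  rw [div_le_iff₀ (by linarith)] at h1 h2
  have h4 : 1 ≤ q.1 := by nlinarith
  nlinarith

lemma snd_eq_one (h : IsCarpet N D F) (hD : ∀ d ∈ D, d.2 + 1 = N) {p : ℝ × ℝ} (hp : p ∈ F) :
    p.2 = 1 := by
  obtain ⟨m, hm, hmin⟩ := h.compact.exists_isMinOn h.conn.nonempty continuous_snd.continuousOn
  obtain ⟨d, hd, q, hq, rfl⟩ := h.exists_phi_eq hm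
  have hN : (2 : ℝ) ≤ N := by exact_mod_cast h.two_le
  have hdN : (d.2 : ℝ) + 1 = N := by exact_mod_cast hD d hd
  have h1 : (q.2 + d.2) / N ≤ q.2 := hmin hq
  have h2 : (q.2 + d.2) / N ≤ p.2 := hmin hp
  have h3 : p.2 ≤ 1 := (h.sub hp).2.2
  rw [div_le_iff₀ (by linarith)] at h1 h2
  have h4 : 1 ≤ q.2 := by nlinarith
  nlinarith

/-- If the cut point `x` is fixed by the lowest digit `d₀`, then a component of `F \ {x}` meeting
a cell of another digit contains the `d₀`-copy of a component meeting the top or right side. -/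
lemma exists_component_phi_eq (h : IsCarpet N D F) {d₀ : ℕ × ℕ} (hd₀ : d₀ ∈ D)
    (hle : ∀ d ∈ D, d₀.1 ≤ d.1 ∧ d₀.2 ≤ d.2) {x : ℝ × ℝ}
    (hxcell : ∀ d ∈ D, d ≠ d₀ → x ∉ phi N d '' F) (hxfix : phi N d₀ x = x) {p : ℝ × ℝ}
    {d : ℕ × ℕ} (hd : d ∈ D) (hne : d ≠ d₀)
    (hmeet : (connectedComponentIn (F \ {x}) p ∩ phi N d '' F).Nonempty) :
    ∃ q ∈ F \ {x}, MeetsTopRight (connectedComponentIn (F \ {x}) q) ∧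
      connectedComponentIn (F \ {x}) (phi N d₀ q) = connectedComponentIn (F \ {x}) p := by
  classical
  set C := connectedComponentIn (F \ {x}) p with hC
  let E : Finset (ℕ × ℕ) := D.filter fun e => e ≠ d₀ ∧ (C ∩ phi N e '' F).Nonempty
  have hEC : ∀ e ∈ E, phi N e '' F ⊆ C := by
    intro e he
    obtain ⟨heD, hene, r, hrC, hr⟩ := Finset.mem_filter.1 he
    rw [hC, connectedComponentIn_eq hrC]
    refine (h.isConnected_cell e).isPreconnected.subset_connectedComponentIn hr ?_
    rintro _ ⟨s, hs, rfl⟩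
    refine ⟨h.phi_mem heD hs, fun hsx => hxcell e heD hene ?_⟩
    exact ⟨s, hs, hsx⟩
  have hEd : d ∈ E := Finset.mem_filter.2 ⟨hd, hne, hmeet⟩
  have hd₀E : d₀ ∈ D \ E := Finset.mem_sdiff.2 ⟨hd₀, fun hmem => (Finset.mem_filter.1 hmem).2.1 rfl⟩
  obtain ⟨s, hs⟩ := h.conn.nonempty
  have hclosed (G : Finset (ℕ × ℕ)) : IsClosed (⋃ e ∈ G, phi N e '' F) :=
    G.finite_toSet.isClosed_biUnion fun e _ => h.isClosed_cell e
  obtain ⟨r, -, hrE, hrE'⟩ := isPreconnected_closed_iff.1 h.conn.isPreconnected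
    (⋃ e ∈ E, phi N e '' F) (⋃ e ∈ D \ E, phi N e '' F) (hclosed _) (hclosed _)
    (by
      intro r hr
      obtain ⟨e, he, q, hq, rfl⟩ := h.exists_phi_eq hr
      by_cases heE : e ∈ E
      · exact Or.inl (mem_biUnion heE (mem_image_of_mem _ hq))
      · exact Or.inr (mem_biUnion (Finset.mem_sdiff.2 ⟨he, heE⟩) (mem_image_of_mem _ hq)))
    ⟨phi N d s, h.phi_mem hd hs, mem_biUnion hEd (mem_image_of_mem _ hs)⟩
    ⟨phi N d₀ s, h.phi_mem hd₀ hs, mem_biUnion hd₀E (mem_image_of_mem _ hs)⟩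
  obtain ⟨e, he, hre⟩ := mem_iUnion₂.1 hrE
  obtain ⟨e', he', hre'⟩ := mem_iUnion₂.1 hrE'
  have hrC : r ∈ C := hEC e he hre
  obtain ⟨heD', heE'⟩ := Finset.mem_sdiff.1 he'
  obtain rfl : e' = d₀ := by
    by_contra hne'
    exact heE' (Finset.mem_filter.2 ⟨heD', hne', r, hrC, hre'⟩)
  obtain ⟨q, hq, rfl⟩ := hre'
  obtain ⟨b, hb, hbq⟩ := hre
  have hqx : q ∈ F \ {x} := by
    refine ⟨hq, ?_⟩
    rintro rfl
    exact (connectedComponentIn_subset _ _ hrC).2 hxfix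
  refine ⟨q, hqx, ⟨q, mem_connectedComponentIn hqx, ?_⟩, (connectedComponentIn_eq hrC).symm⟩
  obtain ⟨h1, h2⟩ := (phi_eq_phi_iff h.ne_zero).1 hbq
  obtain ⟨heD, hene, -⟩ := Finset.mem_filter.1 he
  obtain ⟨hle1, hle2⟩ := hle e heD
  obtain ⟨⟨b1, b2⟩, -⟩ := h.sub hb
  obtain ⟨-, q3, q4⟩ := h.sub hq
  simp only at b1 b2 q3 q4
  rcases hle1.lt_or_eq with hlt | heq
  · have : (e'.1 : ℝ) + 1 ≤ e.1 := by exact_mod_cast hlt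
    exact Or.inl (by linarith)
  · rcases hle2.lt_or_eq with hlt | heq'
    · have : (e'.2 : ℝ) + 1 ≤ e.2 := by exact_mod_cast hlt
      exact Or.inr (by linarith)
    · exact absurd (Prod.ext heq.symm heq'.symm) hene

/-- Every component of a carpet punctured at a cut point meets the top or the right side. -/
theorem meetsTopRight (h : IsCarpet N D F) {x z : ℝ × ℝ} (hxF : x ∈ F)
    (hcut : ¬ IsPreconnected (F \ {x})) (hz : z ∈ F \ {x}) :
    MeetsTopRight (connectedComponentIn (F \ {x}) z) := by
  by_contra hA
  have hx : x ∈ cornerCutPoints F := ⟨⟨hxF, hcut⟩, z, hz, hA⟩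
  obtain ⟨d₀, hcorner⟩ := h.exists_isCornerDigit
  have hd₀ := hcorner.1
  have hxfix := h.phi_eq_self_of_mem_cornerCutPoints hcorner hx
  have huniq : ∀ d, IsCornerDigit D d → d = d₀ := by
    intro d hd
    have heq := (phi_eq_phi_iff h.ne_zero).1
      ((h.phi_eq_self_of_mem_cornerCutPoints hd hx).trans hxfix.symm)
    exact Prod.ext (by exact_mod_cast add_left_cancel heq.1)
      (by exact_mod_cast add_left_cancel heq.2)
  have hle : ∀ d ∈ D, d₀.1 ≤ d.1 ∧ d₀.2 ≤ d.2 :=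
    fun d hd => le_of_unique_cornerDigit huniq _ d hd rfl
  have hzA := mem_connectedComponentIn hz
  have hd₀1 : d₀.1 + 1 < N := by
    by_contra! hge
    refine hA ⟨z, hzA, Or.inl (h.fst_eq_one (fun d hd => ?_) hz.1)⟩
    have := (h.lt d hd).1
    have := (hle d hd).1
    omega
  have hd₀2 : d₀.2 + 1 < N := by
    by_contra! hge
    refine hA ⟨z, hzA, Or.inr (h.snd_eq_one (fun d hd => ?_) hz.1)⟩
    have := (h.lt d hd).2
    have := (hle d hd).2
    omega
  have hd₀1' : (d₀.1 : ℝ) + 1 < N := by exact_mod_cast hd₀1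
  have hd₀2' : (d₀.2 : ℝ) + 1 < N := by exact_mod_cast hd₀2
  have hNpos : (0 : ℝ) < N := by exact_mod_cast Nat.pos_of_ne_zero h.ne_zero
  have hcell_lt : ∀ q ∈ F, (phi N d₀ q).1 < 1 ∧ (phi N d₀ q).2 < 1 := by
    intro q hq
    obtain ⟨-, q3, q4⟩ := h.sub hq
    simp only at q3 q4
    simp only [phi, div_lt_one hNpos]
    exact ⟨by linarith, by linarith⟩
  have hxcell : ∀ d ∈ D, d ≠ d₀ → x ∉ phi N d '' F := by
    rintro d hd hne ⟨q, hq, hqx⟩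
    obtain ⟨h1, h2⟩ := (phi_eq_phi_iff h.ne_zero).1 (hqx.trans hxfix.symm)
    have hx1 := hcell_lt x hxF
    rw [hxfix] at hx1
    obtain ⟨⟨q1, q2⟩, -⟩ := h.sub hq
    simp only at q1 q2
    have e1 : (d.1 : ℝ) < (d₀.1 + 1 : ℕ) := by push_cast; linarith
    have e2 : (d.2 : ℝ) < (d₀.2 + 1 : ℕ) := by push_cast; linarith
    have e1' := Nat.cast_lt.1 e1
    have e2' := Nat.cast_lt.1 e2
    have := hle d hd
    exact hne (Prod.ext (by omega) (by omega))
  have hmaps {w : ℝ × ℝ} (hw : w ∈ F \ {x}) : phi N d₀ w ∈ F \ {x} := by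
    refine ⟨h.phi_mem hd₀ hw.1, fun hxw => hw.2 (h.phi_injective d₀ ?_)⟩
    rw [mem_singleton_iff.1 hxw, hxfix]
  let S : Set (Set (ℝ × ℝ)) := {C | MeetsTopRight C ∧ ∃ p ∈ F \ {x},
    C = connectedComponentIn (F \ {x}) p}
  let f : Set (ℝ × ℝ) → Set (ℝ × ℝ) :=
    fun C => ⋃ p ∈ C, connectedComponentIn (F \ {x}) (phi N d₀ p)
  have hf : ∀ p ∈ F \ {x}, f (connectedComponentIn (F \ {x}) p) =
      connectedComponentIn (F \ {x}) (phi N d₀ p) := by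
    intro p hp
    refine (iUnion₂_subset fun q hq => ?_).antisymm
      (subset_biUnion_of_mem (u := fun p => connectedComponentIn (F \ {x}) (phi N d₀ p))
        (mem_connectedComponentIn hp))
    rw [connectedComponentIn_eq (y := phi N d₀ q) (x := phi N d₀ p)]
    refine IsPreconnected.subset_connectedComponentIn
      (isPreconnected_connectedComponentIn.image _ (h.continuous_phi d₀).continuousOn)
      (mem_image_of_mem _ (mem_connectedComponentIn hp)) ?_ (mem_image_of_mem _ hq)
    rintro _ ⟨r, hr, rfl⟩
    exact hmaps (connectedComponentIn_subset _ _ hr)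
  have hSmeet : ∀ C ∈ S, ∃ d ∈ D, d ≠ d₀ ∧ (C ∩ phi N d '' F).Nonempty := by
    rintro C ⟨⟨r, hr, hr1⟩, p, hp, rfl⟩
    obtain ⟨d, hd, q, hq, rfl⟩ := h.exists_phi_eq (connectedComponentIn_subset _ _ hr).1
    refine ⟨d, hd, ?_, _, hr, mem_image_of_mem _ hq⟩
    rintro rfl
    have := hcell_lt q hq
    rcases hr1 with hr1 | hr1 <;> linarith
  obtain ⟨s, hs⟩ := h.conn.nonempty
  have hSfin : S.Finite := by
    refine ((D.finite_toSet).image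
      fun d => connectedComponentIn (F \ {x}) (phi N d s)).subset ?_
    intro C hC
    obtain ⟨d, hd, hne, r, hrC, hr⟩ := hSmeet C hC
    obtain ⟨-, p, hp, rfl⟩ := hC
    refine ⟨d, hd, ?_⟩
    rw [connectedComponentIn_eq hrC]
    refine (connectedComponentIn_eq ?_).symm
    refine (h.isConnected_cell d).isPreconnected.subset_connectedComponentIn hr ?_
      (mem_image_of_mem _ hs)
    rintro t ht
    refine ⟨?_, fun htx => hxcell d hd hne (mem_singleton_iff.1 htx ▸ ht)⟩
    obtain ⟨u, hu, rfl⟩ := ht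
    exact h.phi_mem hd hu
  have hlift : ∀ p ∈ F \ {x}, ∀ d ∈ D, d ≠ d₀ →
      (connectedComponentIn (F \ {x}) p ∩ phi N d '' F).Nonempty →
      connectedComponentIn (F \ {x}) p ∈ f '' S := by
    intro p hp d hd hne hmeet
    obtain ⟨q, hq, hq1, heq⟩ := h.exists_component_phi_eq hd₀ hle hxcell hxfix hd hne hmeet
    exact ⟨_, ⟨hq1, q, hq, rfl⟩, (hf q hq).trans heq⟩
  have hSsub : S ⊆ f '' S := by
    intro C hC
    obtain ⟨d, hd, hne, hmeet⟩ := hSmeet C hC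
    obtain ⟨-, p, hp, rfl⟩ := hC
    exact hlift p hp d hd hne hmeet
  have hSeq : S = f '' S :=
    Set.eq_of_subset_of_ncard_le hSsub (Set.ncard_image_le hSfin) (hSfin.image f)
  have hdescend : ∀ n : ℕ, ∀ p ∈ F \ {x}, connectedComponentIn (F \ {x}) p ∉ S →
      dist p x ≤ (1 / (N : ℝ)) ^ n := by
    intro n
    induction n with
    | zero => exact fun p hp _ => by simpa using h.dist_le_one hp.1 hxF
    | succ n ih =>
      intro p hp hpS
      obtain ⟨d, hd, q, hq, rfl⟩ := h.exists_phi_eq hp.1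
      obtain rfl : d = d₀ := by
        by_contra hne
        refine hpS (hSeq ▸ hlift _ hp d hd hne ⟨_, mem_connectedComponentIn hp, ?_⟩)
        exact mem_image_of_mem _ hq
      have hqx : q ∈ F \ {x} := by
        refine ⟨hq, ?_⟩
        rintro rfl
        exact hp.2 hxfix
      have hqS : connectedComponentIn (F \ {x}) q ∉ S := by
        intro hqS
        rw [hSeq, ← hf q hqx] at hpS
        exact hpS (mem_image_of_mem _ hqS)
      nth_rewrite 1 [← hxfix]
      rw [dist_phi, pow_succ, mul_one_div]
      exact div_le_div_of_nonneg_right (ih q hqx hqS) hNpos.le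
  obtain ⟨n, hn⟩ := exists_pow_lt_of_lt_one (dist_pos.2 hz.2) h.inv_lt_one
  exact absurd (hdescend n z hz fun hS => hA hS.1) (not_le.2 hn)

/-- Carpets are preserved by symmetries of the square which permute the cells. -/
lemma image (h : IsCarpet N D F) (ρ : ℝ × ℝ ≃ₜ ℝ × ℝ) (δ : ℕ × ℕ → ℕ × ℕ)
    (hδ : ∀ d : ℕ × ℕ, d.1 < N ∧ d.2 < N → (δ d).1 < N ∧ (δ d).2 < N)
    (hρ : ∀ d : ℕ × ℕ, d.1 < N ∧ d.2 < N → ∀ p, ρ (phi N d p) = phi N (δ d) (ρ p))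
    (hsq : ∀ p ∈ Icc ((0 : ℝ), (0 : ℝ)) (1, 1), ρ p ∈ Icc ((0 : ℝ), (0 : ℝ)) (1, 1)) :
    IsCarpet N (D.image δ) (ρ '' F) where
  two_le := h.two_le
  lt d hd := by
    obtain ⟨e, he, rfl⟩ := Finset.mem_image.1 hd
    exact hδ e (h.lt e he)
  compact := h.compact.image ρ.continuous
  attr := by
    ext p
    simp only [mem_iUnion, exists_prop, Finset.mem_image]
    constructor
    · rintro ⟨q, hq, rfl⟩
      obtain ⟨d, hd, r, hr, rfl⟩ := h.exists_phi_eq hq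
      exact ⟨δ d, ⟨d, hd, rfl⟩, ρ r, mem_image_of_mem _ hr, (hρ d (h.lt d hd) r).symm⟩
    · rintro ⟨_, ⟨d, hd, rfl⟩, _, ⟨r, hr, rfl⟩, rfl⟩
      exact ⟨phi N d r, h.phi_mem hd hr, hρ d (h.lt d hd) r⟩
  conn := h.conn.image _ ρ.continuous.continuousOn
  sub := by
    rintro _ ⟨p, hp, rfl⟩
    exact hsq p (h.sub hp)
  fin := by
    refine (h.fin.image ρ).subset ?_
    rintro _ ⟨⟨p, hp, rfl⟩, hcut⟩
    refine ⟨p, ⟨hp, fun hpre => hcut ?_⟩, rfl⟩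
    rw [← image_singleton, ← image_sdiff ρ.injective]
    exact hpre.image _ ρ.continuous.continuousOn

lemma exists_image_eq_one (ρ : ℝ × ℝ ≃ₜ ℝ × ℝ) {D' : Finset (ℕ × ℕ)}
    (hρ : IsCarpet N D' (ρ '' F)) {x z : ℝ × ℝ} (hxF : x ∈ F)
    (hcut : ¬ IsPreconnected (F \ {x})) (hz : z ∈ F \ {x}) :
    ∃ p ∈ connectedComponentIn (F \ {x}) z, (ρ p).1 = 1 ∨ (ρ p).2 = 1 := by
  have himage : ρ '' F \ {ρ x} = ρ '' (F \ {x}) := by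
    rw [image_sdiff ρ.injective, image_singleton]
  have hmeet := hρ.meetsTopRight (x := ρ x) (z := ρ z) (mem_image_of_mem _ hxF)
    (by rwa [himage, ρ.isPreconnected_image]) (by rw [himage]; exact mem_image_of_mem _ hz)
  rw [himage, ← ρ.image_connectedComponentIn hz] at hmeet
  obtain ⟨_, ⟨p, hp, rfl⟩, hp1⟩ := hmeet
  exact ⟨p, hp, hp1⟩

/-- Every component of a carpet punctured at a cut point joins two opposite sides. -/
theorem isVertical_or_isHorizontal (h : IsCarpet N D F) {x z : ℝ × ℝ} (hxF : x ∈ F)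
    (hcut : ¬ IsPreconnected (F \ {x})) (hz : z ∈ F \ {x}) :
    IsVertical (connectedComponentIn (F \ {x}) z) ∨
      IsHorizontal (connectedComponentIn (F \ {x}) z) := by
  have hN : (N : ℝ) ≠ 0 := by exact_mod_cast h.ne_zero
  have hcast {a : ℕ} (ha : a < N) : ((N - 1 - a : ℕ) : ℝ) = N - 1 - a := by
    rw [Nat.cast_sub (by omega), Nat.cast_sub (by omega), Nat.cast_one]
  let r : ℝ ≃ₜ ℝ := Homeomorph.subLeft 1
  have hr (t : ℝ) : r t = 1 - t := rfl
  have hrev {F' : Set (ℝ × ℝ)} {D' : Finset (ℕ × ℕ)} (h' : IsCarpet N D' F') :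
      IsCarpet N (D'.image fun d => (N - 1 - d.1, d.2))
        ((r.prodCongr (Homeomorph.refl ℝ)) '' F') := by
    refine h'.image _ _ (fun d hd => ⟨by omega, hd.2⟩) (fun d hd p => ?_) (fun p hp => ?_)
    · simp only [phi, Homeomorph.coe_prodCongr, Prod.map, hr, Homeomorph.refl_apply, id,
        hcast hd.1]
      congr 1
      field_simp
      ring
    · simp only [mem_Icc, Prod.le_def, Homeomorph.coe_prodCongr, Prod.map, hr,
        Homeomorph.refl_apply, id] at hp ⊢
      exact ⟨⟨by linarith, hp.1.2⟩, by linarith, hp.2.2⟩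
  have hrev' {F' : Set (ℝ × ℝ)} {D' : Finset (ℕ × ℕ)} (h' : IsCarpet N D' F') :
      IsCarpet N (D'.image fun d => (d.1, N - 1 - d.2))
        (((Homeomorph.refl ℝ).prodCongr r) '' F') := by
    refine h'.image _ _ (fun d hd => ⟨hd.1, by omega⟩) (fun d hd p => ?_) (fun p hp => ?_)
    · simp only [phi, Homeomorph.coe_prodCongr, Prod.map, hr, Homeomorph.refl_apply, id,
        hcast hd.2]
      congr 1
      field_simp
      ring
    · simp only [mem_Icc, Prod.le_def, Homeomorph.coe_prodCongr, Prod.map, hr,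
        Homeomorph.refl_apply, id] at hp ⊢
      exact ⟨⟨hp.1.1, by linarith⟩, hp.2.1, by linarith⟩
  have hboth : IsCarpet N ((D.image fun d => (N - 1 - d.1, d.2)).image fun d => (d.1, N - 1 - d.2))
      (((r.prodCongr (Homeomorph.refl ℝ)).trans ((Homeomorph.refl ℝ).prodCongr r)) '' F) := by
    have := hrev' (hrev h)
    rwa [← image_comp] at this
  obtain ⟨a, haC, ha⟩ := h.meetsTopRight hxF hcut hz
  obtain ⟨b, hbC, hb⟩ := exists_image_eq_one _ (hrev h) hxF hcut hz
  obtain ⟨c, hcC, hc⟩ := exists_image_eq_one _ (hrev' h) hxF hcut hz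
  obtain ⟨e, heC, he⟩ := exists_image_eq_one _ hboth hxF hcut hz
  simp only [Homeomorph.trans_apply, Homeomorph.coe_prodCongr, Prod.map, hr,
    Homeomorph.refl_apply, id, sub_eq_self] at hb hc he
  have hside {p : ℝ × ℝ} (hp : p ∈ connectedComponentIn (F \ {x}) z) :
      p.1 ∈ Icc (0 : ℝ) 1 ∧ p.2 ∈ Icc (0 : ℝ) 1 := by
    obtain ⟨⟨h1, h2⟩, h3, h4⟩ := h.sub (connectedComponentIn_subset _ _ hp).1
    exact ⟨⟨h1, h3⟩, h2, h4⟩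
  have hT {p : ℝ × ℝ} (hp : p ∈ connectedComponentIn (F \ {x}) z) (h1 : p.2 = 1) :
      (connectedComponentIn (F \ {x}) z ∩ {p | p.2 = 1 ∧ p.1 ∈ Icc (0 : ℝ) 1}).Nonempty :=
    ⟨p, hp, h1, (hside hp).1⟩
  have hB {p : ℝ × ℝ} (hp : p ∈ connectedComponentIn (F \ {x}) z) (h1 : p.2 = 0) :
      (connectedComponentIn (F \ {x}) z ∩ {p | p.2 = 0 ∧ p.1 ∈ Icc (0 : ℝ) 1}).Nonempty :=
    ⟨p, hp, h1, (hside hp).1⟩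
  have hR {p : ℝ × ℝ} (hp : p ∈ connectedComponentIn (F \ {x}) z) (h1 : p.1 = 1) :
      (connectedComponentIn (F \ {x}) z ∩ {p | p.1 = 1 ∧ p.2 ∈ Icc (0 : ℝ) 1}).Nonempty :=
    ⟨p, hp, h1, (hside hp).2⟩
  have hL {p : ℝ × ℝ} (hp : p ∈ connectedComponentIn (F \ {x}) z) (h1 : p.1 = 0) :
      (connectedComponentIn (F \ {x}) z ∩ {p | p.1 = 0 ∧ p.2 ∈ Icc (0 : ℝ) 1}).Nonempty :=
    ⟨p, hp, h1, (hside hp).2⟩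
  have haC' := ha.imp (hR haC) (hT haC)
  have hbC' := hb.imp (hL hbC) (hT hbC)
  have hcC' := hc.imp (hR hcC) (hB hcC)
  have heC' := he.imp (hL heC) (hB heC)
  unfold IsVertical IsHorizontal
  tauto

/-- If the components of `F \ {x}` have a monotone property `P` incompatible with `Q`, then so do
those components of `F \ {y}` which are known to have `P` or `Q`. -/
lemma transfer (h : IsCarpet N D F) {P Q : Set (ℝ × ℝ) → Prop}
    (hPmono : ∀ {A B : Set (ℝ × ℝ)}, A ⊆ B → P A → P B)
    (hQmono : ∀ {A B : Set (ℝ × ℝ)}, A ⊆ B → Q A → Q B)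
    (hPQ : ∀ {K M : Set (ℝ × ℝ)}, IsCompact K → IsCompact M → IsConnected K → IsConnected M →
      K ⊆ Icc (0, 0) (1, 1) → M ⊆ Icc (0, 0) (1, 1) → P K → Q M → ¬ Disjoint K M)
    {x y : ℝ × ℝ} (hcut : ¬ IsPreconnected (F \ {x}))
    (hP : ∀ z ∈ F \ {x}, P (connectedComponentIn (F \ {x}) z))
    (hy : ∀ z ∈ F \ {y}, P (connectedComponentIn (F \ {y}) z) ∨
      Q (connectedComponentIn (F \ {y}) z)) :
    ∀ z ∈ F \ {y}, P (connectedComponentIn (F \ {y}) z) := by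
  intro z hz
  rcases eq_or_ne x y with rfl | hxy
  · exact hP z hz
  refine (hy z hz).elim id fun hQ => ?_
  obtain ⟨w, hw, hyw⟩ : ∃ w ∈ F \ {x}, y ∉ connectedComponentIn (F \ {x}) w := by
    by_contra! hall
    refine hcut ?_
    have hsub : F \ {x} ⊆ connectedComponentIn (F \ {x}) y := fun w hw =>
      connectedComponentIn_eq (hall w hw) ▸ mem_connectedComponentIn hw
    rw [hsub.antisymm (connectedComponentIn_subset _ _)]
    exact isPreconnected_connectedComponentIn
  have hclF (u v : ℝ × ℝ) : closure (connectedComponentIn (F \ {u}) v) ⊆ F :=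
    h.compact.isClosed.closure_subset_iff.2 ((connectedComponentIn_subset _ _).trans sdiff_subset)
  have hclcompact (u v : ℝ × ℝ) : IsCompact (closure (connectedComponentIn (F \ {u}) v)) :=
    h.compact.of_isClosed_subset isClosed_closure (hclF u v)
  have hclconn {u v : ℝ × ℝ} (hv : v ∈ F \ {u}) :
      IsConnected (closure (connectedComponentIn (F \ {u}) v)) :=
    (isConnected_connectedComponentIn_iff.2 hv).closure
  have hycl : y ∉ closure (connectedComponentIn (F \ {x}) w) := fun hmem =>
    hyw (closure_connectedComponentIn_inter_subset ⟨hmem, hclF _ _ hmem, hxy.symm⟩)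
  by_cases hdisj : Disjoint (closure (connectedComponentIn (F \ {x}) w))
      (connectedComponentIn (F \ {y}) z)
  · refine absurd ?_ (hPQ (hclcompact x w) (hclcompact y z) (hclconn hw) (hclconn hz)
      ((hclF _ _).trans h.sub) ((hclF _ _).trans h.sub) (hPmono subset_closure (hP w hw))
      (hQmono subset_closure hQ))
    refine Set.disjoint_left.2 fun p hp hp' => Set.disjoint_left.1 hdisj hp
      (closure_connectedComponentIn_inter_subset ⟨hp', hclF _ _ hp', ?_⟩)
    rintro rfl
    exact hycl hp
  · obtain ⟨p, hpx, hpy⟩ := Set.not_disjoint_iff.1 hdisj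
    refine hPmono (subset_closure.trans ?_) (hP w hw)
    rw [connectedComponentIn_eq hpy]
    refine (hclconn hw).isPreconnected.subset_connectedComponentIn hpx fun q hq =>
      ⟨hclF _ _ hq, ?_⟩
    rintro rfl
    exact hycl hq

end IsCarpet

lemma IsVertical.mono {A B : Set (ℝ × ℝ)} (hAB : A ⊆ B) (hA : IsVertical A) : IsVertical B :=
  ⟨hA.1.mono (inter_subset_inter_left _ hAB), hA.2.mono (inter_subset_inter_left _ hAB)⟩

lemma IsHorizontal.mono {A B : Set (ℝ × ℝ)} (hAB : A ⊆ B) (hA : IsHorizontal A) :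
    IsHorizontal B :=
  ⟨hA.1.mono (inter_subset_inter_left _ hAB), hA.2.mono (inter_subset_inter_left _ hAB)⟩

/-- Suppose the connected GSC F has finitely many but at least one cut point.
If for some cut point x all connected components of F \ {x} are vertical
(resp. horizontal), then the same holds at every cut point y. -/
theorem stmt18 (N : ℕ) (hN : 2 ≤ N) (D : Finset (ℕ × ℕ))
    (hD : ∀ d ∈ D, d.1 < N ∧ d.2 < N) (hDcard : 1 < D.card ∧ D.card < N ^ 2)
    (F : Set (ℝ × ℝ)) (hFne : F.Nonempty) (hFc : IsCompact F)
    (hFattr : F = ⋃ d ∈ D, phi N d '' F) (hFconn : IsConnected F)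
    (hFsub : F ⊆ Icc (0, 0) (1, 1))
    (CF : Set (ℝ × ℝ))
    (hCF : CF = {y : ℝ × ℝ | y ∈ F ∧ ¬ IsPreconnected (F \ {y})})
    (hfin : CF.Finite) (hne : CF.Nonempty)
    (x : ℝ × ℝ) (hx : x ∈ CF) :
    ((∀ z ∈ F \ {x}, IsVertical (connectedComponentIn (F \ {x}) z)) →
      ∀ y ∈ CF, ∀ z ∈ F \ {y}, IsVertical (connectedComponentIn (F \ {y}) z)) ∧
    ((∀ z ∈ F \ {x}, IsHorizontal (connectedComponentIn (F \ {x}) z)) →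
      ∀ y ∈ CF, ∀ z ∈ F \ {y}, IsHorizontal (connectedComponentIn (F \ {y}) z)) := by
  have hF : IsCarpet N D F := ⟨hN, hD, hFc, hFattr, hFconn, hFsub, hCF ▸ hfin⟩
  have hcut {y : ℝ × ℝ} (hy : y ∈ CF) : y ∈ F ∧ ¬ IsPreconnected (F \ {y}) := by
    rwa [hCF] at hy
  refine ⟨fun hv y hy => ?_, fun hh y hy => ?_⟩
  · exact hF.transfer IsVertical.mono IsHorizontal.mono vertical_inter_horizontal (hcut hx).2 hv
      fun z hz => hF.isVertical_or_isHorizontal (hcut hy).1 (hcut hy).2 hz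
  · refine hF.transfer IsHorizontal.mono IsVertical.mono ?_ (hcut hx).2 hh
      fun z hz => (hF.isVertical_or_isHorizontal (hcut hy).1 (hcut hy).2 hz).symm
    exact fun hK hM hKc hMc hKI hMI hKh hMv hdisj =>
      vertical_inter_horizontal hM hK hMc hKc hMI hKI hMv hKh hdisj.symm
end

section
/- Let F be a connected GSC with 0 < #C_F < ∞ and let x ∈ C_F be such that all connected components of F \ {x} are vertical. Then F \ {x} has exactly two connected components. -/
open Set

/-- A continuous complex function on the plane has a zero if its imaginary part is nonnegative below
the unit square and nonpositive on the three other sides, and its real part is negative at the left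
bottom corner of the square and positive at the right one. -/
theorem exists_eq_zero_of_boundary_halfPlanes {f : ℝ × ℝ → ℂ} (hf : Continuous f)
    (hup : ∀ p : ℝ × ℝ, p.2 ≤ 0 → 0 ≤ (f p).im)
    (hleft : ∀ p : ℝ × ℝ, p.1 ≤ 0 → 0 ≤ p.2 → (f p).im ≤ 0)
    (hright : ∀ p : ℝ × ℝ, 1 ≤ p.1 → 0 ≤ p.2 → (f p).im ≤ 0)
    (htop : ∀ p : ℝ × ℝ, 1 ≤ p.2 → (f p).im ≤ 0)
    (h₀ : (f (0, 0)).re < 0) (h₁ : 0 < (f (1, 0)).re) : ∃ p, f p = 0 := by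
  by_contra! hne
  obtain ⟨L, ⟨-, hL⟩, -⟩ := Complex.isCoveringMapOn_exp.existsUnique_continuousMap_lifts
    ⟨f, hf⟩ (a₀ := ((0, 0) : ℝ × ℝ)) (Complex.exp_log (hne (0, 0))) (fun a ↦ hne a)
  have hexp (p) : Complex.exp (L p) = f p := congrFun hL p
  set g : ℝ × ℝ → ℝ := fun p ↦ (L p).im
  have hgc : Continuous g := Complex.continuous_im.comp L.continuous
  have hre (p) : (f p).re = Real.exp (L p).re * Real.cos (g p) := by
    rw [← hexp, Complex.exp_re]
  have him (p) : (f p).im = Real.exp (L p).re * Real.sin (g p) := by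
    rw [← hexp, Complex.exp_im]
  have sin_nonneg {p} (h : 0 ≤ (f p).im) : 0 ≤ Real.sin (g p) := by
    rw [him] at h
    exact nonneg_of_mul_nonneg_right h (Real.exp_pos _)
  have sin_nonpos {p} (h : (f p).im ≤ 0) : Real.sin (g p) ≤ 0 := by
    rw [him] at h
    exact nonpos_of_mul_nonpos_right h (Real.exp_pos _)
  have sin₀ : Real.sin (g (0, 0)) = 0 :=
    le_antisymm (sin_nonpos (hleft _ le_rfl le_rfl)) (sin_nonneg (hup _ le_rfl))
  have sin₁ : Real.sin (g (1, 0)) = 0 :=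
    le_antisymm (sin_nonpos (hright _ le_rfl le_rfl)) (sin_nonneg (hup _ le_rfl))
  have cos₀ : Real.cos (g (0, 0)) = -1 := by
    rcases Real.sin_eq_zero_iff_cos_eq.1 sin₀ with h | h
    · rw [hre, h] at h₀
      linarith [Real.exp_pos (L (0, 0)).re]
    · exact h
  have cos₁ : Real.cos (g (1, 0)) = 1 := by
    rcases Real.sin_eq_zero_iff_cos_eq.1 sin₁ with h | h
    · exact h
    · rw [hre, h] at h₁
      linarith [Real.exp_pos (L (1, 0)).re]
  obtain ⟨k, hk⟩ := Real.cos_eq_neg_one_iff.1 cos₀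
  obtain ⟨j, hj⟩ := (Real.cos_eq_one_iff _).1 cos₁
  have hpi := Real.pi_pos
  have sin_low (m : ℤ) : Real.sin (-(Real.pi / 2) + m * (2 * Real.pi)) = -1 := by
    rw [Real.sin_add_int_mul_two_pi, Real.sin_neg, Real.sin_pi_div_two]
  have sin_high (m : ℤ) : Real.sin (Real.pi / 2 + m * (2 * Real.pi)) = 1 := by
    rw [Real.sin_add_int_mul_two_pi, Real.sin_pi_div_two]
  have upper : (g '' {p | p.2 ≤ 0}).OrdConnected :=
    ((((convex_Iic (0 : ℝ)).linear_preimage (LinearMap.snd ℝ ℝ ℝ)).isPreconnected).image g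
      hgc.continuousOn).ordConnected
  have mem₀ : g (0, 0) ∈ g '' {p | p.2 ≤ 0} := mem_image_of_mem g (le_refl (0 : ℝ))
  have mem₁ : g (1, 0) ∈ g '' {p | p.2 ≤ 0} := mem_image_of_mem g (le_refl (0 : ℝ))
  have upper_avoid (m : ℤ) : -(Real.pi / 2) + m * (2 * Real.pi) ∉ g '' {p | p.2 ≤ 0} := by
    rintro ⟨p, hp, h⟩
    have := sin_nonneg (hup p hp)
    rw [h, sin_low] at this
    linarith
  have hjk : j = k := by
    rcases lt_trichotomy j k with h | h | h
    · refine absurd (upper.out mem₁ mem₀ ⟨?_, ?_⟩) (upper_avoid k)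
      · have : (j : ℝ) + 1 ≤ k := by exact_mod_cast h
        nlinarith
      · linarith
    · exact h
    · refine absurd (upper.out mem₀ mem₁ ⟨?_, ?_⟩) (upper_avoid (k + 1))
      · push_cast
        linarith
      · have : (k : ℝ) + 1 ≤ j := by exact_mod_cast h
        push_cast
        nlinarith
  set T : Set (ℝ × ℝ) := (Iic 0 ×ˢ Ici 0 ∪ univ ×ˢ Ici 1) ∪ Ici 1 ×ˢ Ici 0
  have T_conn : IsPreconnected T := by
    refine IsPreconnected.union (1, 1) (by simp) (by simp) (IsPreconnected.union (0, 1) (by simp)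
      (by simp) ?_ ?_) ?_
    · exact isPreconnected_Iic.prod isPreconnected_Ici
    · exact isPreconnected_univ.prod isPreconnected_Ici
    · exact isPreconnected_Ici.prod isPreconnected_Ici
  have lower := (T_conn.image g hgc.continuousOn).ordConnected
  obtain ⟨p, hp, h⟩ : Real.pi / 2 + k * (2 * Real.pi) ∈ g '' T := by
    have corner₀ : ((0, 0) : ℝ × ℝ) ∈ T := Or.inl (Or.inl ⟨self_mem_Iic, self_mem_Ici⟩)
    have corner₁ : ((1, 0) : ℝ × ℝ) ∈ T := Or.inr ⟨self_mem_Ici, self_mem_Ici⟩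
    refine lower.out (mem_image_of_mem g corner₁) (mem_image_of_mem g corner₀) ⟨?_, ?_⟩
    · rw [← hj, hjk]
      linarith
    · linarith
  have : (f p).im ≤ 0 := by
    rcases hp with (hp | hp) | hp
    · exact hleft p hp.1 hp.2
    · exact htop p hp.2
    · exact hright p hp.1 hp.2
  have := sin_nonpos this
  rw [h, sin_high] at this
  linarith

/-- The horizontal strip of height one. -/
abbrev unitStrip : Set (ℝ × ℝ) := univ ×ˢ Icc 0 1

/-- In the strip, a path joining two points of the bottom line meets every path which joins a point
of the bottom line between them to the top line. -/
theorem exists_path_eq_of_unitStrip {a b c d : unitStrip} (α : Path a c) (β : Path b d)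
    (ha : a.1.2 = 0) (hb : b.1.2 = 0) (hc : c.1.2 = 0) (hd : d.1.2 = 1)
    (hab : a.1.1 < b.1.1) (hbc : b.1.1 < c.1.1) : ∃ s t, α s = β t := by
  have hα (s) : 0 ≤ (α.extend s).1.2 := (α.extend s).2.2.1
  have hα' (s) : (α.extend s).1.2 ≤ 1 := (α.extend s).2.2.2
  have hβ (s) : 0 ≤ (β.extend s).1.2 := (β.extend s).2.2.1
  obtain ⟨⟨s, t⟩, h⟩ := exists_eq_zero_of_boundary_halfPlanes
    (f := fun p ↦ ⟨(α.extend p.1).1.1 - (β.extend p.2).1.1,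
      (α.extend p.1).1.2 - (β.extend p.2).1.2⟩)
    (by
      have h₁ := α.continuous_extend
      have h₂ := β.continuous_extend
      have : Continuous fun p : ℝ × ℝ ↦ Complex.equivRealProdCLM.symm
          ((α.extend p.1).1 - (β.extend p.2).1) := by fun_prop
      exact this)
    (fun p hp ↦ by simpa [β.extend_of_le_zero hp, hb] using hα p.1)
    (fun p hp _ ↦ by simpa [α.extend_of_le_zero hp, ha] using hβ p.2)
    (fun p hp _ ↦ by simpa [α.extend_of_one_le hp, hc] using hβ p.2)
    (fun p hp ↦ by simpa [β.extend_of_one_le hp, hd] using hα' p.1)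
    (by simpa using hab) (by simpa using hbc)
  simp only [Complex.ext_iff, Complex.zero_re, Complex.zero_im, sub_eq_zero] at h
  exact ⟨_, _, Subtype.ext (Prod.ext h.1 h.2)⟩

/-- In a locally path connected space, a preconnected subset of an open set `U` lies in one path
component of `U`. -/
theorem joinedIn_of_isPreconnected_subset_isOpen {X : Type*} [TopologicalSpace X]
    [LocallyPathConnectedSpace X] {T U : Set X} (hT : IsPreconnected T) (hU : IsOpen U)
    (hTU : T ⊆ U) {a b : X} (ha : a ∈ T) (hb : b ∈ T) : JoinedIn U a b := by
  have hconn : IsConnected (connectedComponentIn U a) :=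
    isConnected_connectedComponentIn_iff.2 (hTU ha)
  have hpath := (hU.connectedComponentIn (x := a)).isConnected_iff_isPathConnected.1 hconn
  have hsub := hT.subset_connectedComponentIn ha hTU
  exact (hpath.joinedIn a (hsub ha) b (hsub hb)).mono (connectedComponentIn_subset U a)

/-- In the strip, a compact connected set through two points of the bottom line meets every
connected set containing a point of the top line and a point of the bottom line between the two. -/
theorem not_disjoint_of_unitStrip {K B : Set (ℝ × ℝ)} (hK : IsPreconnected K) (hKc : IsCompact K)
    (hB : IsPreconnected B) (hKS : K ⊆ unitStrip) (hBS : B ⊆ unitStrip) {a b c d : ℝ × ℝ}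
    (haK : a ∈ K) (hcK : c ∈ K) (hbB : b ∈ B) (hdB : d ∈ B)
    (ha : a.2 = 0) (hb : b.2 = 0) (hc : c.2 = 0) (hd : d.2 = 1)
    (hab : a.1 < b.1) (hbc : b.1 < c.1) : ¬ Disjoint K B := by
  intro hdisj
  have : LocallyPathConnectedSpace unitStrip :=
    (convex_univ.prod (convex_Icc (0 : ℝ) 1)).locallyPathConnectedSpace
  have preconn {T : Set (ℝ × ℝ)} (hT : IsPreconnected T) (hTS : T ⊆ unitStrip) :
      IsPreconnected ((↑) ⁻¹' T : Set unitStrip) := by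
    refine Topology.IsInducing.subtypeVal.isPreconnected_image.1 ?_
    rwa [Subtype.image_preimage_coe, inter_eq_right.2 hTS]
  have hKo : IsOpen ((↑) ⁻¹' Kᶜ : Set unitStrip) :=
    hKc.isClosed.isOpen_compl.preimage continuous_subtype_val
  obtain ⟨β, hβ⟩ := joinedIn_of_isPreconnected_subset_isOpen (preconn hB hBS) hKo
    (fun p hp hpK ↦ hdisj.notMem_of_mem_left hpK hp) (a := ⟨b, hBS hbB⟩) (b := ⟨d, hBS hdB⟩) hbB hdB
  have hβo : IsOpen (range β)ᶜ := (isCompact_range β.continuous).isClosed.isOpen_compl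
  obtain ⟨α, hα⟩ := joinedIn_of_isPreconnected_subset_isOpen (preconn hK hKS) hβo
    (by rintro p hp ⟨t, rfl⟩; exact hβ t hp) (a := ⟨a, hKS haK⟩) (b := ⟨c, hKS hcK⟩) haK hcK
  obtain ⟨s, t, hst⟩ := exists_path_eq_of_unitStrip α β ha hb hc hd hab hbc
  exact hα s ⟨t, hst.symm⟩

/-- In a compact Hausdorff space, a closed set disjoint from the connected component of `z` misses
a clopen set containing `z`. -/
theorem exists_isClopen_disjoint_of_disjoint_connectedComponent {X : Type*} [TopologicalSpace X]
    [CompactSpace X] [T2Space X] {z : X} {s : Set X} (hs : IsClosed s)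
    (h : Disjoint s (connectedComponent z)) : ∃ Q, IsClopen Q ∧ z ∈ Q ∧ Disjoint s Q := by
  rw [connectedComponent_eq_iInter_isClopen, disjoint_iff_inter_eq_empty] at h
  obtain ⟨t, ht⟩ := hs.isCompact.elim_finite_subfamily_closed _
    (fun Q : { Q : Set X // IsClopen Q ∧ z ∈ Q } ↦ Q.2.1.1) h
  exact ⟨⋂ Q ∈ t, Q.1, isClopen_biInter_finset fun Q _ ↦ Q.2.1, mem_iInter₂.2 fun Q _ ↦ Q.2.2,
    disjoint_iff_inter_eq_empty.2 ht⟩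

/-- In a compact connected Hausdorff space, the components of the complement of a point accumulate
at that point. -/
theorem mem_closure_connectedComponentIn_compl_singleton {X : Type*} [TopologicalSpace X]
    [CompactSpace X] [T2Space X] [PreconnectedSpace X] {x z : X} (hzx : z ≠ x) :
    x ∈ closure (connectedComponentIn {x}ᶜ z) := by
  by_contra hx
  obtain ⟨C, ⟨hC, hCc⟩, hCA⟩ := (closed_nhds_basis x).mem_iff.1
    (isClosed_closure.isOpen_compl.mem_nhds hx)
  have hxC : x ∈ interior C := mem_interior_iff_mem_nhds.2 hC
  have hzC : z ∈ (interior C)ᶜ := fun h ↦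
    hCA (interior_subset h) (subset_closure (mem_connectedComponentIn hzx))
  have hY : IsClosed (interior C)ᶜ := isOpen_interior.isClosed_compl
  have : CompactSpace ↥(interior C)ᶜ := isCompact_iff_compactSpace.1 hY.isCompact
  have hsub : (↑) '' connectedComponent (⟨z, hzC⟩ : ↥(interior C)ᶜ) ⊆
      connectedComponentIn {x}ᶜ z := by
    refine (isPreconnected_connectedComponent.image _
      continuous_subtype_val.continuousOn).subset_connectedComponentIn
      (mem_image_of_mem _ mem_connectedComponent) ?_
    rintro _ ⟨p, -, rfl⟩ h
    exact p.2 (mem_singleton_iff.1 h ▸ hxC)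
  obtain ⟨Q, hQ, hzQ, hCQ⟩ := exists_isClopen_disjoint_of_disjoint_connectedComponent
    (z := (⟨z, hzC⟩ : ↥(interior C)ᶜ)) (hCc.preimage continuous_subtype_val)
    (disjoint_left.2 fun p hpC hp ↦ hCA hpC (subset_closure (hsub (mem_image_of_mem _ hp))))
  obtain ⟨O, hO, rfl⟩ := isOpen_induced_iff.1 hQ.2
  have hopen : Subtype.val '' (Subtype.val ⁻¹' O : Set ↥(interior C)ᶜ) = O ∩ Cᶜ := by
    ext p
    constructor
    · rintro ⟨p, hp, rfl⟩
      exact ⟨hp, fun hpC ↦ disjoint_left.1 hCQ hpC hp⟩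
    · rintro ⟨hpO, hpC⟩
      exact ⟨⟨p, fun h ↦ hpC (interior_subset h)⟩, hpO, rfl⟩
  have hclopen : IsClopen (O ∩ Cᶜ) :=
    ⟨hopen ▸ hY.isClosedMap_subtype_val _ hQ.1, hO.inter hCc.isOpen_compl⟩
  have hxQ : x ∈ O ∩ Cᶜ := hclopen.eq_univ ⟨z, hopen ▸ mem_image_of_mem _ hzQ⟩ ▸ mem_univ x
  exact hxQ.2 (interior_subset hxC)

/-- In a compact connected set, the components of the complement of a point accumulate at that
point. -/
theorem mem_closure_connectedComponentIn_diff_singleton {X : Type*} [TopologicalSpace X] [T2Space X]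
    {F : Set X} (hFc : IsCompact F) (hF : IsPreconnected F) {x z : X} (hx : x ∈ F)
    (hz : z ∈ F \ {x}) : x ∈ closure (connectedComponentIn (F \ {x}) z) := by
  have := isCompact_iff_compactSpace.1 hFc
  have := isPreconnected_iff_preconnectedSpace.1 hF
  have hne : (⟨z, hz.1⟩ : F) ≠ ⟨x, hx⟩ := fun h ↦ hz.2 (congrArg Subtype.val h)
  have hsub : (↑) '' connectedComponentIn {(⟨x, hx⟩ : F)}ᶜ ⟨z, hz.1⟩ ⊆
      connectedComponentIn (F \ {x}) z := by
    refine (isPreconnected_connectedComponentIn.image _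
      continuous_subtype_val.continuousOn).subset_connectedComponentIn
      (mem_image_of_mem _ (mem_connectedComponentIn hne)) ?_
    rintro _ ⟨p, hp, rfl⟩
    exact ⟨p.2, fun h ↦ connectedComponentIn_subset _ _ hp (Subtype.ext h)⟩
  exact closure_mono hsub (image_closure_subset_closure_image continuous_subtype_val
    (mem_image_of_mem _ (mem_closure_connectedComponentIn_compl_singleton hne)))

/-- The components of a punctured closed set are closed up to the puncture. -/
theorem closure_connectedComponentIn_diff_singleton_subset {X : Type*} [TopologicalSpace X]
    {F : Set X} (hF : IsClosed F) {x z : X} (hz : z ∈ F \ {x}) :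
    closure (connectedComponentIn (F \ {x}) z) ⊆ insert x (connectedComponentIn (F \ {x}) z) := by
  intro p hp
  refine or_iff_not_imp_left.2 fun hpx ↦ ?_
  have hpF : p ∈ F := hF.closure_subset_iff.2
    ((connectedComponentIn_subset _ _).trans sdiff_subset) hp
  refine (isPreconnected_connectedComponentIn.subset_closure (subset_insert p _)
    (insert_subset hp subset_closure)).subset_connectedComponentIn
    (mem_insert_of_mem _ (mem_connectedComponentIn hz)) ?_ (mem_insert p _)
  exact insert_subset ⟨hpF, hpx⟩ (connectedComponentIn_subset _ _)

/-- A component of a punctured continuum in the strip which joins the top line to a point of the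
bottom line between two others contains one of these two. -/
theorem connectedComponentIn_eq_or_eq_of_between {F : Set (ℝ × ℝ)} (hFc : IsCompact F)
    (hF : IsPreconnected F) (hFS : F ⊆ unitStrip) {x a b c d : ℝ × ℝ} (hx : x ∈ F)
    (ha : a ∈ F \ {x}) (hb : b ∈ F \ {x}) (hc : c ∈ F \ {x})
    (hd : d ∈ connectedComponentIn (F \ {x}) b)
    (ha₀ : a.2 = 0) (hb₀ : b.2 = 0) (hc₀ : c.2 = 0) (hd₁ : d.2 = 1)
    (hab : a.1 < b.1) (hbc : b.1 < c.1) :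
    connectedComponentIn (F \ {x}) b = connectedComponentIn (F \ {x}) a ∨
      connectedComponentIn (F \ {x}) b = connectedComponentIn (F \ {x}) c := by
  by_contra! hne
  have hclosure (y) : closure (connectedComponentIn (F \ {x}) y) ⊆ F :=
    hFc.isClosed.closure_subset_iff.2 ((connectedComponentIn_subset _ _).trans sdiff_subset)
  have hdisj {y} (hy : y ∈ F \ {x})
      (h : connectedComponentIn (F \ {x}) b ≠ connectedComponentIn (F \ {x}) y) :
      Disjoint (closure (connectedComponentIn (F \ {x}) y))
        (connectedComponentIn (F \ {x}) b) := by
    rw [disjoint_left]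
    intro p hp hpb
    rcases closure_connectedComponentIn_diff_singleton_subset hFc.isClosed hy hp with rfl | hpy
    · exact (connectedComponentIn_subset _ _ hpb).2 rfl
    · exact h ((connectedComponentIn_eq hpb).trans (connectedComponentIn_eq hpy).symm)
  refine not_disjoint_of_unitStrip
    (K := closure (connectedComponentIn (F \ {x}) a) ∪ closure (connectedComponentIn (F \ {x}) c))
    (B := connectedComponentIn (F \ {x}) b) ?_ ?_ isPreconnected_connectedComponentIn
    ((union_subset (hclosure a) (hclosure c)).trans hFS)
    (((connectedComponentIn_subset _ _).trans sdiff_subset).trans hFS)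
    (Or.inl (subset_closure (mem_connectedComponentIn ha)))
    (Or.inr (subset_closure (mem_connectedComponentIn hc)))
    (mem_connectedComponentIn hb) hd ha₀ hb₀ hc₀ hd₁ hab hbc
    (disjoint_union_left.2 ⟨hdisj ha hne.1, hdisj hc hne.2⟩)
  · exact isPreconnected_connectedComponentIn.closure.union x
      (mem_closure_connectedComponentIn_diff_singleton hFc hF hx ha)
      (mem_closure_connectedComponentIn_diff_singleton hFc hF hx hc)
      isPreconnected_connectedComponentIn.closure
  · exact (hFc.of_isClosed_subset isClosed_closure (hclosure a)).union
      (hFc.of_isClosed_subset isClosed_closure (hclosure c))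

/-- Suppose the connected GSC F has finitely many but at least one cut point,
and x is a cut point all of whose complementary components are vertical. Then
F \ {x} has exactly two connected components. -/
theorem stmt19 (N : ℕ) (hN : 2 ≤ N) (D : Finset (ℕ × ℕ))
    (hD : ∀ d ∈ D, d.1 < N ∧ d.2 < N) (hDcard : 1 < D.card ∧ D.card < N ^ 2)
    (F : Set (ℝ × ℝ)) (hFne : F.Nonempty) (hFc : IsCompact F)
    (hFattr : F = ⋃ d ∈ D, phi N d '' F) (hFconn : IsConnected F)
    (hFsub : F ⊆ Icc (0, 0) (1, 1))
    (CF : Set (ℝ × ℝ))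
    (hCF : CF = {y : ℝ × ℝ | y ∈ F ∧ ¬ IsPreconnected (F \ {y})})
    (hfin : CF.Finite) (hne : CF.Nonempty)
    (x : ℝ × ℝ) (hx : x ∈ CF)
    (hvert : ∀ z ∈ F \ {x}, IsVertical (connectedComponentIn (F \ {x}) z)) :
    ∃ y₁ ∈ F \ {x}, ∃ y₂ ∈ F \ {x},
      connectedComponentIn (F \ {x}) y₁ ≠ connectedComponentIn (F \ {x}) y₂ ∧
      ∀ z ∈ F \ {x},
        connectedComponentIn (F \ {x}) z = connectedComponentIn (F \ {x}) y₁ ∨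
        connectedComponentIn (F \ {x}) z = connectedComponentIn (F \ {x}) y₂ := by
  subst hCF
  obtain ⟨hxF, hcut⟩ := hx
  have hFS : F ⊆ unitStrip := fun p hp ↦ ⟨mem_univ _, (hFsub hp).1.2, (hFsub hp).2.2⟩
  obtain ⟨y₁, hy₁, y₂, hy₂, h₁₂⟩ : ∃ y₁ ∈ F \ {x}, ∃ y₂ ∈ F \ {x},
      connectedComponentIn (F \ {x}) y₁ ≠ connectedComponentIn (F \ {x}) y₂ := by
    by_contra! h
    refine hcut (isPreconnected_of_forall_pair fun y hy z hz ↦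
      ⟨connectedComponentIn (F \ {x}) y, connectedComponentIn_subset _ _,
        mem_connectedComponentIn hy, ?_, isPreconnected_connectedComponentIn⟩)
    rw [h y hy z hz]
    exact mem_connectedComponentIn hz
  refine ⟨y₁, hy₁, y₂, hy₂, h₁₂, fun z hz ↦ ?_⟩
  by_contra! h
  have bottom {y} (hy : y ∈ F \ {x}) : ∃ a ∈ F \ {x}, a.2 = 0 ∧
      connectedComponentIn (F \ {x}) y = connectedComponentIn (F \ {x}) a := by
    obtain ⟨a, ha, ha₀, -⟩ := (hvert y hy).1
    exact ⟨a, connectedComponentIn_subset _ _ ha, ha₀, connectedComponentIn_eq ha⟩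
  have between {a b c} (ha : a ∈ F \ {x}) (hb : b ∈ F \ {x}) (hc : c ∈ F \ {x})
      (ha₀ : a.2 = 0) (hb₀ : b.2 = 0) (hc₀ : c.2 = 0) (hab : a.1 < b.1) (hbc : b.1 < c.1) :
      connectedComponentIn (F \ {x}) b = connectedComponentIn (F \ {x}) a ∨
        connectedComponentIn (F \ {x}) b = connectedComponentIn (F \ {x}) c := by
    obtain ⟨d, hd, hd₁, -⟩ := (hvert b hb).2
    exact connectedComponentIn_eq_or_eq_of_between hFc hFconn.isPreconnected hFS hxF ha hb hc hd
      ha₀ hb₀ hc₀ hd₁ hab hbc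
  obtain ⟨a, ha, ha₀, hya⟩ := bottom hy₁
  obtain ⟨b, hb, hb₀, hyb⟩ := bottom hy₂
  obtain ⟨c, hc, hc₀, hzc⟩ := bottom hz
  rw [hya, hyb] at h₁₂
  rw [hya, hyb, hzc] at h
  have fst_ne {p q : ℝ × ℝ} (hp : p.2 = 0) (hq : q.2 = 0)
      (hpq : connectedComponentIn (F \ {x}) p ≠ connectedComponentIn (F \ {x}) q) :
      p.1 ≠ q.1 := by
    rintro h
    exact hpq (congrArg _ (Prod.ext h (hp.trans hq.symm)))
  rcases (fst_ne ha₀ hb₀ h₁₂).lt_or_gt with hab | hab <;>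
  rcases (fst_ne hc₀ ha₀ h.1).lt_or_gt with hca | hca <;>
  rcases (fst_ne hc₀ hb₀ h.2).lt_or_gt with hcb | hcb
  · exact (between hc ha hb hc₀ ha₀ hb₀ hca hab).elim h.1.symm h₁₂
  · exact lt_asymm (hca.trans hab) hcb
  · exact (between ha hc hb ha₀ hc₀ hb₀ hca hcb).elim h.1 h.2
  · exact (between ha hb hc ha₀ hb₀ hc₀ hab hcb).elim h₁₂.symm h.2.symm
  · exact (between hc hb ha hc₀ hb₀ ha₀ hcb hab).elim h.2.symm h₁₂.symm
  · exact (between hb hc ha hb₀ hc₀ ha₀ hcb hca).elim h.2 h.1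
  · exact lt_asymm (hab.trans hca) hcb
  · exact (between hb ha hc hb₀ ha₀ hc₀ hab hca).elim h₁₂ h.1.symm
end
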